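/- arXiv:1603.09613 — 4 statements merged into one kernel-verified Lean document; each statement's English description precedes it below -/
import Mathlib

section
/- Let Π_+ be the set of signed permutation words π ∈ Π(G) whose last letter is positive, and for each i let u_i = #{π ∈ Π_+ : des(π) = i}. Then u_0 = 0, the sequence is symmetric: u_i = u_{d−i} for 1 ≤ i ≤ d−1, and it is unimodal: u_1 ≤ u_2 ≤ … ≤ u_{⌊d/2⌋}. -/
open Set Pointwise

/-- The fractional stable set polytope `FRAC(G)` of a finite simple graph `G` on `Fin d`. -/
def FRAC (d : ℕ) (G : SimpleGraph (Fin d)) : Set (Fin d → ℝ) :=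
  {x | (∀ i, 0 ≤ x i) ∧ ∀ i j, G.Adj i j → x i + x j ≤ 1}

/-- The polytope `Q(G) = 3·FRAC(G) − (1,…,1)`. -/
def Qpoly (d : ℕ) (G : SimpleGraph (Fin d)) : Set (Fin d → ℝ) :=
  {x | (∀ i, -1 ≤ x i) ∧ ∀ i j, G.Adj i j → x i + x j ≤ 1}

/-- The number of lattice points of a subset of `ℝ^d`. -/
noncomputable def latticePts {d : ℕ} (s : Set (Fin d → ℝ)) : ℕ :=
  (s ∩ {x | ∀ i, ∃ z : ℤ, x i = (z : ℝ)}).ncard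

/-- `π : Fin d → ℤ` is a signed permutation word on `[d] = {1,…,d}`:
each letter is one of `±1,…,±d` and the absolute values form a permutation of `1,…,d`. -/
def IsSignedPermWord (d : ℕ) (π : Fin d → ℤ) : Prop :=
  (∀ p, 1 ≤ (π p).natAbs ∧ (π p).natAbs ≤ d) ∧
    Function.Injective fun p => (π p).natAbs

/-- The number of descents of a signed permutation word: position `i` (0-based) is a
descent if `i` is not the last position and `π i > π (i+1)`, or `i` is the last
position and `π i > 0`. -/
noncomputable def des {d : ℕ} (π : Fin d → ℤ) : ℕ :=
  Set.ncard {i : Fin d |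
    (∃ h : (i : ℕ) + 1 < d, π ⟨(i : ℕ) + 1, h⟩ < π i) ∨ ((i : ℕ) + 1 = d ∧ 0 < π i)}

/-- Steingrímsson's set `Π(G)`: signed permutation words such that for every edge
`(i,j)` of `G`, if the letter `+i` appears then the letter `−j` precedes it.
(Vertex `v : Fin d` corresponds to the letter `v+1`.) -/
def PiSet {d : ℕ} (G : SimpleGraph (Fin d)) : Set (Fin d → ℤ) :=
  {π | IsSignedPermWord d π ∧ ∀ i j : Fin d, G.Adj i j →
    ∀ p : Fin d, π p = ((i : ℕ) + 1 : ℤ) →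
      ∃ q : Fin d, q < p ∧ π q = -(((j : ℕ) + 1 : ℤ))}

/-- The dual (polar) of a subset of `ℝ^d`. -/
def polarDual {d : ℕ} (P : Set (Fin d → ℝ)) : Set (Fin d → ℝ) :=
  {x | ∀ y ∈ P, (∑ i, x i * y i) ≤ 1}

/-- The vertex set `{e_i + e_j : (i,j) ∈ E(G)} ∪ {−e_1,…,−e_d}` of the dual of `Q(G)`. -/
def Vset (d : ℕ) (G : SimpleGraph (Fin d)) : Set (Fin d → ℝ) :=
  {x | ∃ i j, G.Adj i j ∧ x = Pi.single i 1 + Pi.single j 1} ∪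
    {x | ∃ i, x = -Pi.single i 1}

/-- The Eulerian number `A(k,i)`: the number of permutations of `{1,…,k}` with
exactly `i` descents. -/
noncomputable def eulerianNumber (k i : ℕ) : ℕ :=
  Set.ncard {σ : Equiv.Perm (Fin k) |
    Set.ncard {j : Fin k | ∃ h : (j : ℕ) + 1 < k, σ ⟨(j : ℕ) + 1, h⟩ < σ j} = i}

/-- The configuration `A ⊂ ℤ^{d+1}` consisting of `(0,1)`, `(e_i+e_j,1)` for edges
`(i,j)`, and `(−e_i,1)`. -/
def Aset (d : ℕ) (G : SimpleGraph (Fin d)) : Set (Fin (d + 1) → ℤ) :=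
  {a | a = Fin.snoc (0 : Fin d → ℤ) (1 : ℤ) ∨
    (∃ i j, G.Adj i j ∧ a = Fin.snoc (Pi.single i 1 + Pi.single j 1) (1 : ℤ)) ∨
    ∃ i, a = Fin.snoc (-Pi.single i 1) (1 : ℤ)}

open Polynomial in
inductive GP : ℕ → ℕ[X] → Prop
  | zero (n : ℕ) : GP n 0
  | add {n : ℕ} {p q : ℕ[X]} : GP n p → GP n q → GP n (p + q)
  | basis (j m n : ℕ) (h : n = 2 * j + m) : GP n (X ^ j * (1 + X) ^ m)

namespace GP
open Polynomial

theorem mul {n m : ℕ} {p q : ℕ[X]} (hp : GP n p) (hq : GP m q) : GP (n + m) (p * q) := by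
  induction hp with
  | zero n => rw [zero_mul]; exact .zero _
  | add _ _ h1 h2 => rw [add_mul]; exact .add h1 h2
  | basis j k n h =>
    induction hq with
    | zero n => rw [mul_zero]; exact .zero _
    | add _ _ h1 h2 => rw [mul_add]; exact .add h1 h2
    | basis j' k' n' h' =>
      have : (X ^ j * (1 + X) ^ k * (X ^ j' * (1 + X) ^ k') : ℕ[X]) =
        X ^ (j + j') * (1 + X) ^ (k + k') := by ring
      rw [this]; exact .basis _ _ _ (by omega)

theorem sum {ι : Type*} {n : ℕ} (s : Finset ι) (f : ι → ℕ[X]) (h : ∀ i ∈ s, GP n (f i)) :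
    GP n (∑ i ∈ s, f i) :=
  Finset.sum_induction f (GP n) (fun _ _ => .add) (.zero n) h

theorem one : GP 0 1 := by simpa using GP.basis 0 0 0 rfl
theorem X' : GP 2 X := by simpa using GP.basis 1 0 2 rfl
theorem one_add_X : GP 1 (1 + X) := by simpa using GP.basis 0 1 1 rfl

theorem symm {n : ℕ} {p : ℕ[X]} (hp : GP n p) : ∀ i ≤ n, p.coeff i = p.coeff (n - i) := by
  induction hp with
  | zero n => simp
  | add _ _ h1 h2 => intro i hi; simp [h1 i hi, h2 i hi]
  | basis j m n h =>
    intro i hi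
    rw [coeff_X_pow_mul', coeff_X_pow_mul', coeff_one_add_X_pow, coeff_one_add_X_pow]
    simp only [Nat.cast_id]
    split_ifs with h1 h2 h2
    · by_cases h3 : i - j ≤ m
      · rw [← Nat.choose_symm h3]; congr 1; omega
      · omega
    · apply Nat.choose_eq_zero_of_lt; omega
    · symm; apply Nat.choose_eq_zero_of_lt; omega
    · rfl

theorem unim {n : ℕ} {p : ℕ[X]} (hp : GP n p) :
    ∀ i, 2 * (i + 1) ≤ n → p.coeff i ≤ p.coeff (i + 1) := by
  induction hp with
  | zero n => simp
  | add _ _ h1 h2 => intro i hi; simp only [coeff_add]; exact add_le_add (h1 i hi) (h2 i hi)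
  | basis j m n h =>
    intro i hi
    rw [coeff_X_pow_mul', coeff_X_pow_mul', coeff_one_add_X_pow, coeff_one_add_X_pow]
    simp only [Nat.cast_id]
    split_ifs with h1 h2
    · rw [show i + 1 - j = (i - j) + 1 by omega]
      exact Nat.choose_le_succ_of_lt_half_left (by omega)
    · omega
    · simp
    · rfl
end GP

def desL : List ℤ → ℕ
  | [] => 0
  | x :: l => (if l.headD x < x then 1 else 0) + desL l

def wt : List ℤ → ℕ
  | [] => 0
  | x :: l => (if l.headD 0 < x then 1 else 0) + wt l

theorem desL_max (M : ℤ) (l1 l2 : List ℤ) (h1 : ∀ x ∈ l1, x < M) (h2 : ∀ x ∈ l2, x < M) :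
    desL (l1 ++ M :: l2) = desL l1 + (if l2 = [] then 0 else 1) + desL l2 := by
  induction l1 with
  | nil =>
    cases l2 with
    | nil => simp [desL]
    | cons y t => simp only [List.mem_cons, forall_eq_or_imp] at h2; simp [desL, h2.1]
  | cons x t ih =>
    simp only [List.mem_cons, forall_eq_or_imp] at h1
    have ih := ih h1.2
    cases t with
    | nil => simp [desL] at ih ⊢; rw [if_neg (by omega)]; split_ifs at * <;> simp_all
    | cons y t => 
      simp only [List.cons_append] at ih ⊢
      rw [desL, ih, desL.eq_2 x (y :: t)]
      by_cases hc : y < x <;> simp only [List.headD_cons, hc, if_true, if_false] <;> omega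

theorem wt_neg (a r : List ℤ) (ha : ∀ x ∈ a, x < 0) (hr : 0 < r.headD 0) :
    wt (a ++ r) = desL a + wt r := by
  induction a with
  | nil => simp [desL]
  | cons x t ih =>
    simp only [List.mem_cons, forall_eq_or_imp] at ha
    have ih := ih ha.2
    cases t with
    | nil =>
      simp only [desL, wt, List.cons_append, List.nil_append, List.headD_nil, lt_irrefl, if_false]
      rw [if_neg (by omega)]
    | cons y t => 
      simp only [List.cons_append] at ih ⊢
      rw [wt, ih, desL.eq_2 x (y :: t)]
      by_cases hc : y < x <;> simp only [List.headD_cons, hc, if_true, if_false] <;> omega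

theorem wt_pos (a r : List ℤ) (hne : a ≠ []) (ha : ∀ x ∈ a, 0 < x) (hr : r.headD 0 ≤ 0) :
    wt (a ++ r) = desL a + 1 + wt r := by
  induction a with
  | nil => simp at hne
  | cons x t ih =>
    simp only [List.mem_cons, forall_eq_or_imp] at ha
    cases t with
    | nil =>
      simp only [desL, wt, List.cons_append, List.nil_append, List.headD_nil, lt_irrefl, if_false]
      rw [if_pos (by omega)]
    | cons y t => 
      have ih := ih (by simp) ha.2
      simp only [List.cons_append] at ih ⊢
      rw [wt, ih, desL.eq_2 x (y :: t)]
      by_cases hc : y < x <;> simp only [List.headD_cons, hc, if_true, if_false] <;> omega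

def LL (s : Finset ℤ) : Finset (List ℤ) := s.val.lists.toFinset

theorem mem_LL {s : Finset ℤ} {l : List ℤ} : l ∈ LL s ↔ l.Nodup ∧ l.toFinset = s := by
  unfold LL
  rw [Multiset.mem_toFinset, Multiset.mem_lists_iff]
  constructor
  · intro h
    have h1 : l.Nodup := by rw [← Multiset.coe_nodup]; rw [← show s.val = (l : Multiset ℤ) from h]; exact s.nodup
    refine ⟨h1, ?_⟩
    ext x
    rw [List.mem_toFinset, ← Multiset.mem_coe, ← show s.val = (l : Multiset ℤ) from h]; rfl
  · rintro ⟨h, rfl⟩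
    simp [List.toFinset_val, h.dedup]

open Polynomial in
noncomputable def AA (s : Finset ℤ) : ℕ[X] := ∑ l ∈ LL s, X ^ desL l

theorem AA_empty : AA ∅ = 1 := by
  unfold AA
  have : LL ∅ = {[]} := by
    ext l; rw [mem_LL]; simp [List.toFinset_eq_empty_iff]; rintro rfl; simp
  rw [this]; simp [desL]

theorem tw_split (q : ℤ → Bool) (a r : List ℤ) (ha : ∀ x ∈ a, q x = true)
    (hr : ∀ x ∈ r.head?, q x = false) :
    (a ++ r).takeWhile q = a ∧ (a ++ r).dropWhile q = r := by
  induction a with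
  | nil =>
    cases r with
    | nil => simp
    | cons y t => simp at hr; simp [hr]
  | cons x t ih =>
    simp only [List.mem_cons, forall_eq_or_imp] at ha
    simp [List.takeWhile_cons, List.dropWhile_cons, ha.1, ih ha.2]

open Polynomial in
theorem AA_rec (s : Finset ℤ) (M : ℤ) (hM : M ∈ s) (hmax : ∀ x ∈ s, x ≤ M) :
    AA s = ∑ t ∈ (s.erase M).powerset,
      (if s.erase M \ t = ∅ then 1 else X) * (AA t * AA (s.erase M \ t)) := by
  unfold AA
  have key : ∀ l ∈ LL s, ∃ l1 l2, l = l1 ++ M :: l2 ∧ l1.toFinset ∈ (s.erase M).powerset ∧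
      l1 ∈ LL l1.toFinset ∧ l2 ∈ LL (s.erase M \ l1.toFinset) ∧
      l.takeWhile (fun x => decide (x ≠ M)) = l1 ∧ l.dropWhile (fun x => decide (x ≠ M)) = M :: l2 := by
    intro l hl
    rw [mem_LL] at hl
    obtain ⟨hn, rfl⟩ := hl
    rw [List.mem_toFinset] at hM
    obtain ⟨l1, l2, rfl⟩ := List.append_of_mem hM
    have hn' := hn
    rw [List.nodup_append] at hn
    obtain ⟨h1, h2, h3⟩ := hn
    rw [List.nodup_cons] at h2
    refine ⟨l1, l2, rfl, ?_, ?_, ?_, ?_⟩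
    · rw [Finset.mem_powerset]
      intro x hx
      simp only [List.mem_toFinset, Finset.mem_erase, List.mem_append, List.mem_cons] at hx ⊢
      exact ⟨fun h => h3 x hx M (by simp) h, .inl hx⟩
    · rw [mem_LL]; exact ⟨h1, rfl⟩
    · rw [mem_LL]; refine ⟨h2.2, ?_⟩
      ext x
      simp only [List.mem_toFinset, Finset.mem_sdiff, Finset.mem_erase, List.mem_append, List.mem_cons]
      constructor
      · intro hx
        exact ⟨⟨fun h => h2.1 (h ▸ hx), .inr (.inr hx)⟩, fun h => h3 x h x (by simp [hx]) rfl⟩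
      · rintro ⟨⟨ha, hb⟩, hc⟩; tauto
    · apply tw_split
      · intro x hx; simp; exact fun h => h3 x hx M (by simp) h
      · simp
  rw [← Finset.sum_fiberwise_of_maps_to (s := LL s) (t := (s.erase M).powerset)
    (g := fun l => (l.takeWhile (fun x => decide (x ≠ M))).toFinset)]
  · apply Finset.sum_congr rfl
    intro t ht
    rw [Finset.mem_powerset] at ht
    rw [Finset.sum_mul_sum, ← Finset.sum_product', Finset.mul_sum]
    apply Finset.sum_nbij'
      (i := fun l => (l.takeWhile (fun x => decide (x ≠ M)), (l.dropWhile (fun x => decide (x ≠ M))).tail))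
      (j := fun p => p.1 ++ M :: p.2)
    · intro l hl
      rw [Finset.mem_filter] at hl
      obtain ⟨l1, l2, h0, h1, h2, h3, h4, h5⟩ := key l hl.1
      have := hl.2
      rw [h4] at this
      simp only [h4, h5, Finset.mem_product, List.tail_cons]
      rw [this] at h2 h3
      exact ⟨h2, h3⟩
    · rintro ⟨l1, l2⟩ hp
      simp only [Finset.mem_product, mem_LL] at hp
      obtain ⟨⟨h1, rfl⟩, h3, h4⟩ := hp
      have hM1 : M ∉ l1 := fun h => by simpa using ht (List.mem_toFinset.2 h)
      have e4 : ∀ x, x ∈ l2 ↔ (x ≠ M ∧ x ∈ s) ∧ x ∉ l1 := by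
        intro x; rw [← List.mem_toFinset, h4]; simp
      rw [Finset.mem_filter, mem_LL, (tw_split _ _ _ _ _).1]
      · refine ⟨⟨?_, ?_⟩, rfl⟩
        · rw [List.nodup_append, List.nodup_cons]
          refine ⟨h1, ⟨by rw [e4]; simp, h3⟩, ?_⟩
          intro a ha b hb hab
          subst hab
          rw [List.mem_cons, e4] at hb
          rcases hb with rfl | hb
          · exact hM1 ha
          · exact hb.2 ha
        · ext x
          simp only [List.mem_toFinset, List.mem_append, List.mem_cons, e4]
          have : x ∈ l1 → x ∈ s := fun h => Finset.mem_of_mem_erase (ht (List.mem_toFinset.2 h))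
          constructor
          · rintro (h | rfl | h)
            exacts [this h, hM, h.1.2]
          · intro h; tauto
      · intro x hx; simp; rintro rfl; exact hM1 hx
      · simp
    · intro l hl
      rw [Finset.mem_filter] at hl
      obtain ⟨l1, l2, h0, h1, h2, h3, h4, h5⟩ := key l hl.1
      simp only [h4, h5, List.tail_cons]
      exact h0.symm
    · rintro ⟨l1, l2⟩ hp
      simp only [Finset.mem_product, mem_LL] at hp
      obtain ⟨⟨h1, rfl⟩, h3, h4⟩ := hp
      have hM1 : M ∉ l1 := fun h => by simpa using ht (List.mem_toFinset.2 h)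
      have := tw_split (fun x => decide (x ≠ M)) l1 (M :: l2) (by intro x hx; simp; rintro rfl; exact hM1 hx) (by simp)
      simp only [this, List.tail_cons]
    · intro l hl
      rw [Finset.mem_filter] at hl
      obtain ⟨l1, l2, h0, h1, h2, h3, h4, h5⟩ := key l hl.1
      simp only [h4, h5, List.tail_cons]
      have h6 := hl.2
      rw [h4] at h6
      subst h6
      have e2 := (mem_LL.1 h3).2
      have hs := (mem_LL.1 hl.1).2
      have hnd := (mem_LL.1 hl.1).1
      subst h0
      rw [desL_max]
      · by_cases hl2 : l2 = []
        · subst hl2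
          simp only [List.toFinset_nil] at e2
          rw [← e2]; simp [pow_add]
        · rw [if_neg hl2, if_neg]
          · ring
          · rw [← e2]; simpa [List.toFinset_eq_empty_iff] using hl2
      · intro x hx
        have := ht (List.mem_toFinset.2 hx)
        rw [Finset.mem_erase] at this
        exact lt_of_le_of_ne (hmax x this.2) this.1
      · intro x hx
        have := List.mem_toFinset.2 hx
        rw [e2, Finset.mem_sdiff, Finset.mem_erase] at this
        exact lt_of_le_of_ne (hmax x this.1.2) this.1.1
  · intro l hl
    obtain ⟨l1, l2, h0, h1, h2, h3, h4, h5⟩ := key l hl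
    simp only [h4]; exact h1

open Polynomial in
theorem AA_GP (n : ℕ) : ∀ s : Finset ℤ, s.card = n + 1 → GP n (AA s) := by
  induction n using Nat.strong_induction_on with
  | _ n ih =>
    intro s hs
    have hne : s.Nonempty := by rw [← Finset.card_pos]; omega
    rw [AA_rec s (s.max' hne) (s.max'_mem hne) (fun x hx => s.le_max' x hx)]
    set s' := s.erase (s.max' hne) with hs'
    have hc : s'.card = n := by rw [hs', Finset.card_erase_of_mem (s.max'_mem hne)]; omega
    rcases Nat.eq_zero_or_pos n with rfl | hn
    · rw [Finset.card_eq_zero] at hc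
      rw [hc]; simp [AA_empty]; exact GP.one
    · have hs'ne : s' ≠ ∅ := by intro h; rw [h] at hc; simp at hc; omega
      rw [← Finset.add_sum_erase _ _ (Finset.empty_mem_powerset s'),
        ← Finset.add_sum_erase (s'.powerset.erase ∅) _ (a := s') (by simp [hs'ne]), ← add_assoc]
      apply GP.add
      · simp only [Finset.sdiff_empty, Finset.sdiff_self, if_neg hs'ne, if_true, AA_empty]
        have := GP.one_add_X.mul (ih (n - 1) (by omega) s' (by omega))
        rw [show 1 + (n - 1) = n by omega] at this
        convert this using 1
        ring
      · apply GP.sum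
        intro t ht
        simp only [Finset.mem_erase, Finset.mem_powerset] at ht
        obtain ⟨h1, h2, h3⟩ := ht
        have c1 : 0 < t.card := by rw [Finset.card_pos]; exact Finset.nonempty_iff_ne_empty.2 h2
        have c2 : t.card < s'.card := Finset.card_lt_card (Finset.ssubset_iff_subset_ne.2 ⟨h3, h1⟩)
        have c3 : (s' \ t).card = s'.card - t.card := Finset.card_sdiff_of_subset h3
        rw [if_neg (by intro h; rw [h] at c3; simp at c3; omega)]
        have := GP.X'.mul ((ih (t.card - 1) (by omega) t (by omega)).mul
          (ih ((s' \ t).card - 1) (by omega) (s' \ t) (by omega)))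
        rwa [show 2 + (t.card - 1 + ((s' \ t).card - 1)) = n by omega] at this

theorem head_dropWhile' (q : ℤ → Bool) (l : List ℤ) : ∀ x ∈ (l.dropWhile q).head?, q x = false := by
  induction l with
  | nil => simp
  | cons y t ih =>
    rw [List.dropWhile_cons]
    split_ifs with h
    · exact ih
    · simpa using h

theorem mem_takeWhile' (q : ℤ → Bool) (l : List ℤ) : ∀ x ∈ l.takeWhile q, q x = true := by
  intro x hx
  exact List.mem_takeWhile_imp hx

def RR (q : ℤ → Bool) (F : Finset (List ℤ)) (s : Finset ℤ) : Finset (List ℤ) :=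
  (F.filter (fun l => (l.takeWhile q).toFinset = s)).image (fun l => l.dropWhile q)

open Polynomial in
theorem step (q : ℤ → Bool) (c : ℕ) (F : Finset (List ℤ)) (hnd : ∀ l ∈ F, l.Nodup)
    (hperm : ∀ a a' r : List ℤ, a ++ r ∈ F → (∀ x ∈ a, q x = true) → a.Perm a' → a' ++ r ∈ F)
    (hw : ∀ l ∈ F, wt l = desL (l.takeWhile q) + c + wt (l.dropWhile q)) :
    (∑ l ∈ F, X ^ wt l : ℕ[X]) = ∑ s ∈ F.image (fun l => (l.takeWhile q).toFinset),
      AA s * (X ^ c * ∑ r ∈ RR q F s, X ^ wt r) := by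
  rw [← Finset.sum_fiberwise_of_maps_to (s := F) (t := F.image (fun l => (l.takeWhile q).toFinset))
    (g := fun l => (l.takeWhile q).toFinset) (fun l hl => Finset.mem_image_of_mem _ hl)]
  apply Finset.sum_congr rfl
  intro s _
  rw [Finset.mul_sum, AA, Finset.sum_mul_sum, ← Finset.sum_product']
  have key : ∀ p ∈ LL s ×ˢ RR q F s, p.1 ++ p.2 ∈ F ∧ (p.1 ++ p.2).takeWhile q = p.1 ∧
      (p.1 ++ p.2).dropWhile q = p.2 := by
    rintro ⟨a, r⟩ hp
    simp only [Finset.mem_product, mem_LL, RR, Finset.mem_image, Finset.mem_filter] at hp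
    obtain ⟨⟨h1, h2⟩, l, ⟨h3, h4⟩, rfl⟩ := hp
    have hl := List.takeWhile_append_dropWhile (p := q) (l := l)
    have hn := hnd l h3
    have hp : (l.takeWhile q).Perm a := by
      apply List.perm_of_nodup_nodup_toFinset_eq _ h1 (h4.trans h2.symm)
      exact hn.sublist (List.takeWhile_sublist _)
    refine ⟨hperm (l.takeWhile q) a _ (by rwa [hl]) (mem_takeWhile' q l) hp, ?_⟩
    apply tw_split
    · intro x hx; exact mem_takeWhile' q l x (hp.mem_iff.2 hx)
    · exact head_dropWhile' q l
  apply Finset.sum_nbij' (i := fun l => (l.takeWhile q, l.dropWhile q)) (j := fun p => p.1 ++ p.2)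
  · intro l hl
    rw [Finset.mem_filter] at hl
    simp only [Finset.mem_product, mem_LL]
    refine ⟨⟨(hnd l hl.1).sublist (List.takeWhile_sublist _), hl.2⟩, ?_⟩
    unfold RR
    exact Finset.mem_image.2 ⟨l, Finset.mem_filter.2 hl, rfl⟩
  · intro p hp
    obtain ⟨h1, h2, h3⟩ := key p hp
    rw [Finset.mem_filter, h2]
    rw [Finset.mem_product, mem_LL] at hp
    exact ⟨h1, hp.1.2⟩
  · intro l _; exact List.takeWhile_append_dropWhile
  · intro p hp
    obtain ⟨h1, h2, h3⟩ := key p hp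
    simp only [h2, h3]
  · intro l hl
    rw [Finset.mem_filter] at hl
    rw [hw l hl.1]
    simp only
    ring

structure HF (n : ℕ) (F : Finset (List ℤ)) : Prop where
  len : ∀ l ∈ F, l.length = n
  nodup : ∀ l ∈ F, l.Nodup
  nz : ∀ l ∈ F, ∀ x ∈ l, x ≠ 0
  last : ∀ l ∈ F, ∀ x ∈ l.getLast?, 0 < x
  swap : ∀ (a : List ℤ) (x y : ℤ) (c : List ℤ), a ++ x :: y :: c ∈ F → (0 < x ↔ 0 < y) →
    a ++ y :: x :: c ∈ F

theorem HF.perm {n : ℕ} {F : Finset (List ℤ)} (h : HF n F) (q : ℤ → Bool)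
    (hq : ∀ x y, q x = true → q y = true → (0 < x ↔ 0 < y)) (a a' : List ℤ) (hp : a.Perm a') :
    (∀ x ∈ a, q x = true) → ∀ pre r, pre ++ (a ++ r) ∈ F → pre ++ (a' ++ r) ∈ F := by
  induction hp with
  | nil => intro _ _ _ h; exact h
  | cons x _ ih =>
    intro hx pre r hm
    have := ih (fun y hy => hx y (by simp [hy])) (pre ++ [x]) r (by simpa using hm)
    simpa using this
  | swap x y l =>
    intro hx pre r hm
    exact h.swap pre y x (l ++ r) hm (hq y x (hx y (by simp)) (hx x (by simp)))
  | trans h1 _ ih1 ih2 =>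
    intro hx pre r hm
    exact ih2 (fun x hx' => hx x (h1.mem_iff.2 hx')) pre r (ih1 hx pre r hm)

theorem HF.RR {n : ℕ} {F : Finset (List ℤ)} (h : HF n F) (q : ℤ → Bool)
    (hq : ∀ x y, x ≠ 0 → y ≠ 0 → (0 < x ↔ 0 < y) → q x = q y) (s : Finset ℤ) :
    HF (n - s.card) (RR q F s) := by
  have key : ∀ r ∈ _root_.RR q F s, ∃ a, a ++ r ∈ F ∧ a.toFinset = s ∧ (∀ x ∈ a, q x = true) ∧
      (∀ x ∈ r.head?, q x = false) := by
    intro r hr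
    simp only [_root_.RR, Finset.mem_image, Finset.mem_filter] at hr
    obtain ⟨l, ⟨h1, h2⟩, rfl⟩ := hr
    exact ⟨l.takeWhile q, by rwa [List.takeWhile_append_dropWhile], h2, mem_takeWhile' q l, head_dropWhile' q l⟩
  constructor
  · intro r hr
    obtain ⟨a, h1, h2, _⟩ := key r hr
    have e := h.len _ h1
    have hn := h.nodup _ h1
    rw [List.nodup_append] at hn
    rw [← h2, List.toFinset_card_of_nodup hn.1, ← e]; simp
  · intro r hr
    obtain ⟨a, h1, h2, _⟩ := key r hr
    exact (h.nodup _ h1).sublist (List.sublist_append_right _ _)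
  · intro r hr x hx
    obtain ⟨a, h1, h2, _⟩ := key r hr
    exact h.nz _ h1 x (by simp [hx])
  · intro r hr x hx
    obtain ⟨a, h1, h2, _⟩ := key r hr
    apply h.last _ h1 x
    rw [Option.mem_def] at hx ⊢
    rw [List.getLast?_append, hx]; rfl
  · intro a x y c hr hxy
    obtain ⟨b, h1, h2, h3, h4⟩ := key _ hr
    have hm : b ++ (a ++ y :: x :: c) ∈ F := by
      have := h.swap (b ++ a) x y c (by simpa using h1) hxy
      simpa using this
    have := tw_split q b (a ++ y :: x :: c) h3 (by
      cases a with
      | nil =>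
        intro z hz
        simp at hz h4
        subst hz
        rw [← h4]; symm
        apply hq _ _ _ _ hxy
        · apply h.nz _ h1; simp
        · apply h.nz _ h1; simp
      | cons w a => simpa using h4)
    simp only [_root_.RR, Finset.mem_image, Finset.mem_filter]
    exact ⟨_, ⟨hm, by rw [this.1, h2]⟩, this.2⟩

open Polynomial in
theorem mainGP (n : ℕ) : ∀ F : Finset (List ℤ), HF n F →
    ((∀ l ∈ F, ∀ x ∈ l.head?, x < 0) → GP n (∑ l ∈ F, X ^ wt l)) ∧
    ((∀ l ∈ F, 0 < l.headD 0) → GP (n + 1) (∑ l ∈ F, X ^ wt l)) := by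
  induction n using Nat.strong_induction_on with
  | _ n ih =>
  intro F h
  constructor
  · intro hh
    rcases Nat.eq_zero_or_pos n with rfl | hn
    · apply GP.sum
      intro l hl
      have := List.length_eq_zero_iff.1 (h.len l hl)
      subst this
      simpa [wt] using GP.one
    · set q : ℤ → Bool := fun x => decide (x < 0) with hq
      have hsplit : ∀ l ∈ F, l.takeWhile q ≠ [] ∧ 0 < (l.dropWhile q).headD 0 := by
        intro l hl
        constructor
        · cases l with
          | nil => have := h.len _ hl; simp at this; omega
          | cons x t =>
            have := hh _ hl x (by simp)
            simp [hq, this]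
        · have h1 := head_dropWhile' q l
          have e := List.takeWhile_append_dropWhile (p := q) (l := l)
          have h3 := mem_takeWhile' q l
          cases hd : l.dropWhile q with
          | nil =>
            exfalso
            rw [hd, List.append_nil] at e
            rw [e] at h3
            have hne : l ≠ [] := by rintro rfl; have := h.len _ hl; simp at this; omega
            have h4 := h3 _ (List.getLast_mem hne)
            have h5 := h.last l hl _ (List.getLast?_eq_some_getLast hne)
            simp [hq] at h4; omega
          | cons x t =>
            rw [hd] at h1 e
            have := h.nz l hl x (by rw [← e]; simp)
            simp [hq] at h1 ⊢; omega
      rw [step q 0 F h.nodup]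
      · apply GP.sum
        intro s hs
        obtain ⟨l, hl, rfl⟩ := Finset.mem_image.1 hs
        have hn1 : (l.takeWhile q).Nodup := (h.nodup l hl).sublist (List.takeWhile_sublist _)
        have c1 : (l.takeWhile q).toFinset.card ≤ n := by
          rw [List.toFinset_card_of_nodup hn1, ← h.len l hl]
          exact (List.takeWhile_sublist _).length_le
        have c2 : 0 < (l.takeWhile q).toFinset.card := by
          rw [List.toFinset_card_of_nodup hn1]
          exact List.length_pos_iff.2 (hsplit l hl).1
        set s := (l.takeWhile q).toFinset
        have hR := h.RR q (by intro x y hx hy hxy; simp only [hq, decide_eq_decide]; omega) s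
        have := (ih (n - s.card) (by omega) _ hR).2 (by
          intro r hr
          simp only [RR, Finset.mem_image, Finset.mem_filter] at hr
          obtain ⟨l', ⟨h1, h2⟩, rfl⟩ := hr
          exact (hsplit l' h1).2)
        rw [pow_zero, one_mul]
        have := (AA_GP (s.card - 1) s (by omega)).mul this
        rwa [show s.card - 1 + (n - s.card + 1) = n by omega] at this
      · intro a a' r hm ha hp
        exact h.perm q (by intro x y hx hy; simp [hq] at hx hy; omega) a a' hp ha [] r hm
      · intro l hl
        conv_lhs => rw [← List.takeWhile_append_dropWhile (p := q) (l := l)]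
        rw [wt_neg, add_zero]
        · intro x hx; simpa [hq] using mem_takeWhile' q l x hx
        · exact (hsplit l hl).2
  · intro hh
    set q : ℤ → Bool := fun x => decide (0 < x) with hq
    have hsplit : ∀ l ∈ F, l.takeWhile q ≠ [] ∧ ∀ x ∈ (l.dropWhile q).head?, x < 0 := by
      intro l hl
      constructor
      · cases l with
        | nil => have := hh _ hl; simp at this
        | cons x t =>
          have := hh _ hl
          simp at this
          simp [hq, this]
      · have h1 := head_dropWhile' q l
        have e := List.takeWhile_append_dropWhile (p := q) (l := l)
        cases hd : l.dropWhile q with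
        | nil => simp
        | cons x t =>
          rw [hd] at h1 e
          have := h.nz l hl x (by rw [← e]; simp)
          simp [hq] at h1 ⊢; omega
    rw [step q 1 F h.nodup]
    · apply GP.sum
      intro s hs
      obtain ⟨l, hl, rfl⟩ := Finset.mem_image.1 hs
      have hn1 : (l.takeWhile q).Nodup := (h.nodup l hl).sublist (List.takeWhile_sublist _)
      have c1 : (l.takeWhile q).toFinset.card ≤ n := by
        rw [List.toFinset_card_of_nodup hn1, ← h.len l hl]
        exact (List.takeWhile_sublist _).length_le
      have c2 : 0 < (l.takeWhile q).toFinset.card := by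
        rw [List.toFinset_card_of_nodup hn1]
        exact List.length_pos_iff.2 (hsplit l hl).1
      set s := (l.takeWhile q).toFinset
      have hR := h.RR q (by intro x y hx hy hxy; simp only [hq, decide_eq_decide]; omega) s
      have := (ih (n - s.card) (by omega) _ hR).1 (by
        intro r hr
        simp only [RR, Finset.mem_image, Finset.mem_filter] at hr
        obtain ⟨l', ⟨h1, h2⟩, rfl⟩ := hr
        exact (hsplit l' h1).2)
      rw [pow_one]
      have := (AA_GP (s.card - 1) s (by omega)).mul (GP.X'.mul this)
      rwa [show s.card - 1 + (2 + (n - s.card)) = n + 1 by omega] at this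
    · intro a a' r hm ha hp
      exact h.perm q (by intro x y hx hy; simp [hq] at hx hy; omega) a a' hp ha [] r hm
    · intro l hl
      conv_lhs => rw [← List.takeWhile_append_dropWhile (p := q) (l := l)]
      rw [wt_pos _ _ (hsplit l hl).1]
      · intro x hx; simpa [hq] using mem_takeWhile' q l x hx
      · have := (hsplit l hl).2
        cases hd : l.dropWhile q with
        | nil => simp
        | cons x t => rw [hd] at this; simp at this ⊢; omega

theorem des_eq_wt (d : ℕ) : ∀ π : Fin d → ℤ, des π = wt (List.ofFn π) := by
  have hdes : ∀ (d : ℕ) (π : Fin d → ℤ), des π = ∑ i : Fin d,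
      if (∃ h : (i : ℕ) + 1 < d, π ⟨(i : ℕ) + 1, h⟩ < π i) ∨ ((i : ℕ) + 1 = d ∧ 0 < π i)
        then 1 else 0 := by
    intro d π
    rw [des, Finset.sum_boole, ← Set.ncard_coe_finset]
    simp
  induction d with
  | zero => intro π; rw [hdes]; simp [wt]
  | succ d ih =>
    intro π
    rw [List.ofFn_succ, wt, ← ih, hdes, hdes, Fin.sum_univ_succ]
    congr 1
    · congr 1
      cases d with
      | zero =>
        apply propext
        constructor
        · rintro (⟨h, _⟩ | ⟨_, h⟩)
          · exact absurd h (by simp)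
          · simpa using h
        · intro h
          exact Or.inr ⟨rfl, by simpa using h⟩
      | succ d => simp
    · apply Finset.sum_congr rfl
      intro i _
      congr 1
      simp

structure LW {d : ℕ} (G : SimpleGraph (Fin d)) (l : List ℤ) : Prop where
  len : l.length = d
  rng : ∀ x ∈ l, 1 ≤ x.natAbs ∧ x.natAbs ≤ d
  nd : (l.map Int.natAbs).Nodup
  pw : l.Pairwise (fun u v => ¬ ∃ i j : Fin d, G.Adj i j ∧ u = ((i : ℕ) + 1 : ℤ) ∧
    v = -(((j : ℕ) + 1 : ℤ)))
  mem : ∀ i j : Fin d, G.Adj i j → ((i : ℕ) + 1 : ℤ) ∈ l → -(((j : ℕ) + 1 : ℤ)) ∈ l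
  last : ∀ x ∈ l.getLast?, 0 < x

theorem LW_iff {d : ℕ} (hd : d - 1 < d) (G : SimpleGraph (Fin d)) (π : Fin d → ℤ) :
    (π ∈ PiSet G ∧ 0 < π ⟨d - 1, hd⟩) ↔ LW G (List.ofFn π) := by
  have hlast : (List.ofFn π).getLast? = some (π ⟨d - 1, hd⟩) := by
    rw [List.getLast?_eq_getElem?, List.getElem?_eq_getElem (by simp; omega)]
    simp
  constructor
  · rintro ⟨⟨⟨h1, h2⟩, h3⟩, h4⟩
    constructor
    · simp
    · intro x hx
      rw [List.mem_ofFn] at hx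
      obtain ⟨p, rfl⟩ := hx
      exact h1 p
    · rw [List.map_ofFn, List.nodup_ofFn]; exact h2
    · rw [List.pairwise_ofFn]
      rintro p p' hpp ⟨i, j, hij, e1, e2⟩
      obtain ⟨q, hq, e3⟩ := h3 i j hij p e1
      have : q = p' := h2 (by simp only [e2, e3])
      exact absurd (this ▸ hq) (not_lt.2 hpp.le)
    · intro i j hij hm
      rw [List.mem_ofFn] at hm ⊢
      obtain ⟨p, hp⟩ := hm
      obtain ⟨q, hq, e3⟩ := h3 i j hij p hp
      exact ⟨q, e3⟩
    · rw [hlast]; simpa using h4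
  · intro h
    have h2 := h.nd
    rw [List.map_ofFn, List.nodup_ofFn] at h2
    refine ⟨⟨⟨fun p => h.rng _ (by simp), h2⟩, ?_⟩, h.last _ hlast⟩
    intro i j hij p hp
    have := h.mem i j hij (by rw [List.mem_ofFn]; exact ⟨p, hp⟩)
    rw [List.mem_ofFn] at this
    obtain ⟨q, hq⟩ := this
    refine ⟨q, ?_, hq⟩
    rcases lt_trichotomy q p with h5 | h5 | h5
    · exact h5
    · subst h5; omega
    · have := h.pw
      rw [List.pairwise_ofFn] at this
      exact absurd ⟨i, j, hij, hp, hq⟩ (this h5)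

theorem LW.swap {d : ℕ} {G : SimpleGraph (Fin d)} {a c : List ℤ} {x y : ℤ}
    (h : LW G (a ++ x :: y :: c)) (hxy : 0 < x ↔ 0 < y) : LW G (a ++ y :: x :: c) := by
  have hp : (a ++ x :: y :: c).Perm (a ++ y :: x :: c) :=
    List.Perm.append_left a (List.Perm.swap y x c)
  constructor
  · rw [← hp.length_eq]; exact h.len
  · intro z hz; exact h.rng z (hp.mem_iff.2 hz)
  · exact ((hp.map _).nodup_iff).1 h.nd
  · have := h.pw
    rw [List.pairwise_append, List.pairwise_cons, List.pairwise_cons] at this ⊢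
    obtain ⟨h1, ⟨h2, h3, h4⟩, h5⟩ := this
    refine ⟨h1, ⟨?_, fun z hz => h2 z (by simp [hz]), h4⟩, ?_⟩
    · intro z hz
      rw [List.mem_cons] at hz
      rcases hz with rfl | hz
      · rintro ⟨i, j, _, e1, e2⟩; omega
      · exact h3 z hz
    · intro u hu v hv
      apply h5 u hu v
      simp only [List.mem_cons] at hv ⊢; tauto
  · intro i j hij hm
    exact hp.mem_iff.1 (h.mem i j hij (hp.mem_iff.2 hm))
  · have := h.last
    cases c with
    | nil => simp at this ⊢; omega
    | cons z c => simpa [List.getLast?_append, List.getLast?_cons] using this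

theorem LW.head {d : ℕ} {G : SimpleGraph (Fin d)} (hiso : ∀ i : Fin d, ∃ j, G.Adj i j) {l : List ℤ}
    (h : LW G l) : ∀ x ∈ l.head?, x < 0 := by
  intro x hx
  cases l with
  | nil => simp at hx
  | cons y t =>
    simp at hx
    subst hx
    by_contra hc
    have hr := h.rng y (by simp)
    let i : Fin d := ⟨y.natAbs - 1, by omega⟩
    have hi : y = ((i : ℕ) + 1 : ℤ) := by simp only [i]; omega
    obtain ⟨j, hj⟩ := hiso i
    have := h.mem i j hj (by rw [← hi]; simp)
    rw [List.mem_cons] at this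
    rcases this with h1 | h1
    · omega
    · exact (List.pairwise_cons.1 h.pw).1 _ h1 ⟨i, j, hj, hi, rfl⟩

/-- the descent generating numbers of `Π_+` (words in `Π(G)` with
positive last letter) satisfy `u_0 = 0`, symmetry and unimodality. -/
theorem stmt2 (d : ℕ) (hd : 2 ≤ d) (G : SimpleGraph (Fin d))
    (hiso : ∀ i : Fin d, ∃ j, G.Adj i j) (u : ℕ → ℕ)
    (hu : ∀ i, u i = Set.ncard {π : Fin d → ℤ |
      π ∈ PiSet G ∧ 0 < π ⟨d - 1, by omega⟩ ∧ des π = i}) :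
    u 0 = 0 ∧ (∀ i, 1 ≤ i → i ≤ d - 1 → u i = u (d - i)) ∧
      (∀ i, 1 ≤ i → i + 1 ≤ d / 2 → u i ≤ u (i + 1)) := by
  have hfin : {π : Fin d → ℤ | π ∈ PiSet G ∧ 0 < π ⟨d - 1, by omega⟩}.Finite := by
    apply (Set.Finite.pi' (fun _ : Fin d => Set.finite_Icc (-(d : ℤ)) d)).subset
    rintro π ⟨⟨⟨h1, _⟩, _⟩, _⟩ i
    have := (h1 i).2
    rw [Set.mem_Icc]; omega
  set W := hfin.toFinset with hW
  have hWm : ∀ π, π ∈ W ↔ LW G (List.ofFn π) := by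
    intro π; rw [← LW_iff (show d - 1 < d by omega), hW, Set.Finite.mem_toFinset]; rfl
  have hFm : ∀ l, l ∈ W.image List.ofFn ↔ LW G l := by
    intro l
    rw [Finset.mem_image]
    constructor
    · rintro ⟨π, h, rfl⟩; exact (hWm π).1 h
    · intro h
      have hl := h.len
      have e : List.ofFn (fun i : Fin d => l.get (i.cast hl.symm)) = l := by
        subst hl; simp
      exact ⟨_, (hWm _).2 (by rw [e]; exact h), e⟩
  have hHF : HF d (W.image List.ofFn) := by
    constructor
    · intro l hl; exact ((hFm l).1 hl).len
    · intro l hl; exact ((hFm l).1 hl).nd.of_map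
    · intro l hl x hx; have := ((hFm l).1 hl).rng x hx; omega
    · intro l hl; exact ((hFm l).1 hl).last
    · intro a x y c hl hxy; exact (hFm _).2 (((hFm _).1 hl).swap hxy)
  have hGP := (mainGP d _ hHF).1 (fun l hl => ((hFm l).1 hl).head hiso)
  rw [Finset.sum_image (fun _ _ _ _ h => List.ofFn_injective h)] at hGP
  have hcoeff : ∀ i, u i = (∑ π ∈ W, (Polynomial.X ^ wt (List.ofFn π) : Polynomial ℕ)).coeff i := by
    intro i
    rw [hu, Polynomial.finset_sum_coeff]
    simp only [Polynomial.coeff_X_pow, Finset.sum_boole, Nat.cast_id]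
    rw [← Set.ncard_coe_finset]
    congr 1
    ext π
    simp only [Finset.coe_filter, Set.mem_setOf_eq, hWm, ← LW_iff (show d - 1 < d by omega), ← des_eq_wt, and_assoc]
    rw [eq_comm (a := i)]
  refine ⟨?_, ?_, ?_⟩
  · rw [hu, Set.ncard_eq_zero (hfin.subset (fun π h => ⟨h.1, h.2.1⟩))]
    ext π
    simp only [Set.mem_setOf_eq, Set.mem_empty_iff_false, iff_false]
    rintro ⟨_, h1, h2⟩
    rw [des, Set.ncard_eq_zero (Set.toFinite _)] at h2
    have : (⟨d - 1, by omega⟩ : Fin d) ∈ (∅ : Set (Fin d)) := by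
      rw [← h2]; right; exact ⟨by simp; omega, h1⟩
    exact this
  · intro i hi hi'
    rw [hcoeff, hcoeff]; exact hGP.symm i (by omega)
  · intro i hi hi'
    rw [hcoeff, hcoeff]; exact hGP.unim i (by omega)
end

section
/- There exists a polynomial p ∈ ℚ[x] of degree d such that p(n) = #(n·P(G) ∩ ℤ^d) for every integer n ≥ 0 (the Ehrhart polynomial of P(G) = 2·FRAC(G)), and for every integer k ≥ 0 one has #((2k+1)·FRAC(G) ∩ ℤ^d) = (−1)^d · p(−k−2). -/
open Set Pointwise

def ChainP (K : ℤ) {m : ℕ} (lo : ℤ) (c : Fin m → ℤ) (n : ℤ) (b : Fin m → ℤ) : Prop :=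
  (∀ k, lo < K * b k + c k) ∧ StrictMono (fun k => K * b k + c k) ∧ ∀ k, b k ≤ n

lemma chainP_succ (K : ℤ) {m : ℕ} (lo : ℤ) (c : Fin (m+1) → ℤ) (n : ℤ) (b : Fin (m+1) → ℤ) :
    ChainP K lo c n b ↔ (lo < K * b 0 + c 0 ∧ b 0 ≤ n) ∧
      ChainP K (K * b 0 + c 0) (Fin.tail c) n (Fin.tail b) := by
  constructor
  · rintro ⟨h1, h2, h3⟩
    refine ⟨⟨h1 0, h3 0⟩, fun k => ?_, fun k l hkl => ?_, fun k => h3 k.succ⟩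
    · exact h2 (Fin.succ_pos k)
    · exact h2 (Fin.succ_lt_succ_iff.2 hkl)
  · rintro ⟨⟨h0, h0'⟩, h1, h2, h3⟩
    refine ⟨fun k => ?_, fun k l hkl => ?_, fun k => ?_⟩
    · refine Fin.cases h0 (fun k => ?_) k
      exact h0.trans (h1 k)
    · induction l using Fin.cases with
      | zero => exact absurd hkl (Fin.not_lt_zero k)
      | succ l =>
        induction k using Fin.cases with
        | zero => exact h1 l
        | succ k => exact h2 (Fin.succ_lt_succ_iff.1 hkl)
    · exact Fin.cases h0' (fun k => h3 k) k

lemma sum_choose_aux (w m : ℕ) (hw : w ≤ m) (N : ℕ) :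
    ∑ t ∈ Finset.range N, (t + w).choose m = (N + w).choose (m+1) := by
  induction N with
  | zero => simp [Nat.choose_eq_zero_of_lt (Nat.lt_succ_of_le hw)]
  | succ N ih =>
    rw [Finset.sum_range_succ, ih, show N + 1 + w = (N + w) + 1 by ring, Nat.choose_succ_succ]
    ring

def chainEquiv (K : ℤ) {m : ℕ} (β : ℤ) (n δ N : ℕ) (hN : N + δ = n + 1) (cm : ℤ)
    (c : Fin (m+1) → ℤ) (hδ : ∀ z : ℤ, K * β + cm < K * z + c 0 ↔ β + δ ≤ z) :
    {b // ChainP K (K * β + cm) c (β + n) b} ≃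
      Σ t : Fin N, {b : Fin m → ℤ // ChainP K (K * (β + δ + (t:ℕ)) + c 0) (Fin.tail c)
        ((β + δ + (t : ℕ)) + (N - 1 - (t:ℕ) : ℕ)) b} where
  toFun b := ⟨⟨(b.1 0 - β - δ).toNat, by
      obtain ⟨b, hb⟩ := b
      have h := (chainP_succ _ _ _ _ _).1 hb
      have := (hδ _).1 h.1.1
      have := h.1.2
      simp only
      omega⟩, ⟨Fin.tail b.1, by
      obtain ⟨b, hb⟩ := b
      have h := (chainP_succ _ _ _ _ _).1 hb
      have h1 := (hδ _).1 h.1.1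
      have h2 := h.1.2
      have e1 : β + δ + ((b 0 - β - δ).toNat : ℤ) = b 0 := by omega
      have e2 : b 0 + ((N - 1 - (b 0 - β - δ).toNat : ℕ) : ℤ) = β + n := by omega
      simp only
      rw [e1, e2]
      exact h.2⟩⟩
  invFun x := ⟨Fin.cons (β + δ + (x.1 : ℕ)) x.2.1, by
      obtain ⟨⟨t, ht⟩, b, hb⟩ := x
      rw [chainP_succ]
      simp only [Fin.cons_zero, Fin.tail_cons]
      refine ⟨⟨(hδ _).2 (by omega), by omega⟩, ?_⟩
      convert hb using 1
      simp only
      omega⟩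
  left_inv b := by
      obtain ⟨b, hb⟩ := b
      have h := (chainP_succ _ _ _ _ _).1 hb
      have h1 := (hδ _).1 h.1.1
      apply Subtype.ext
      simp only
      have e1 : β + δ + ((b 0 - β - δ).toNat : ℤ) = b 0 := by omega
      rw [e1]
      exact Fin.cons_self_tail b
  right_inv x := by
      obtain ⟨⟨t, ht⟩, b, hb⟩ := x
      have e1 : (β + δ + (t : ℤ) - β - δ).toNat = t := by omega
      refine Sigma.ext ?_ ?_
      · simp [e1]
      · simp only
        refine (Subtype.heq_iff_coe_eq ?_).2 ?_
        · intro x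
          simp [e1]
        · simp

lemma chain_step (K : ℤ) {m : ℕ} (cm : ℤ) (c : Fin (m+1) → ℤ) (w : ℕ) (hw : w ≤ m) (δ : ℕ)
    (hδ1 : δ ≤ 1)
    (hδ : ∀ β z : ℤ, K * β + cm < K * z + c 0 ↔ β + δ ≤ z)
    (ih : ∀ (β : ℤ) (n : ℕ), Finite {b // ChainP K (K * β + c 0) (Fin.tail c) (β + n) b} ∧
      Nat.card {b // ChainP K (K * β + c 0) (Fin.tail c) (β + n) b} = (n + w).choose m)
    (β : ℤ) (n : ℕ) : Finite {b // ChainP K (K * β + cm) c (β + n) b} ∧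
      Nat.card {b // ChainP K (K * β + cm) c (β + n) b} = (n + 1 - δ + w).choose (m+1) := by
  have e := chainEquiv K β n δ (n + 1 - δ) (by omega) cm c (hδ β)
  have : ∀ t : Fin (n+1-δ), Finite {b : Fin m → ℤ // ChainP K (K * (β + δ + (t:ℕ)) + c 0) (Fin.tail c)
        ((β + δ + (t : ℕ)) + ((n+1-δ) - 1 - (t:ℕ) : ℕ)) b} := fun t => (ih _ _).1
  refine ⟨Finite.of_equiv _ e.symm, ?_⟩
  rw [Nat.card_congr e, Nat.card_sigma]
  simp only [(ih _ _).2]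
  rw [Fin.sum_univ_eq_sum_range (fun t => (n + 1 - δ - 1 - t + w).choose m),
    Finset.sum_range_reflect (fun t => (t + w).choose m), sum_choose_aux _ _ hw]

lemma delta_of_lt (K cm c : ℤ) (h1 : 2 * |cm| < K) (h2 : 2 * |c| < K) (h : cm < c) (β z : ℤ) :
    K * β + cm < K * z + c ↔ β + ((0 : ℕ) : ℤ) ≤ z := by
  have := abs_lt.1 (show |c - cm| < K by have := abs_sub c cm; omega)
  constructor
  · intro h'
    by_contra hz
    have : z + 1 ≤ β := by simp at hz; omega
    nlinarith
  · intro h'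
    simp at h'
    nlinarith

lemma delta_of_gt (K cm c : ℤ) (h1 : 2 * |cm| < K) (h2 : 2 * |c| < K) (h : c < cm) (β z : ℤ) :
    K * β + cm < K * z + c ↔ β + ((1 : ℕ) : ℤ) ≤ z := by
  have := abs_lt.1 (show |c - cm| < K by have := abs_sub c cm; omega)
  constructor
  · intro h'
    by_contra hz
    have : z ≤ β := by push_cast at hz; omega
    nlinarith
  · intro h'
    push_cast at h'
    nlinarith

lemma chain_count (K : ℤ) (m : ℕ) : ∀ (cm : ℤ) (c : Fin m → ℤ), 2 * |cm| < K →
    (∀ k, 2 * |c k| < K) → (∀ k, c k ≠ cm) → Function.Injective c → ∃ w ≤ m,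
    (∀ (β : ℤ) (n : ℕ), Finite {b // ChainP K (K * β + cm) c (β + n) b} ∧
      Nat.card {b // ChainP K (K * β + cm) c (β + n) b} = (n + w).choose m) ∧
    (∀ (β : ℤ) (n : ℕ), Finite {b // ChainP K (K * β + -cm) (fun k => - c k) (β + n) b} ∧
      Nat.card {b // ChainP K (K * β + -cm) (fun k => - c k) (β + n) b} =
        (n + (m - w)).choose m) := by
  induction m with
  | zero =>
    intro cm c h1 h2 h3 h4
    have key : ∀ (lo n : ℤ) (c : Fin 0 → ℤ), Finite {b // ChainP K lo c n b} ∧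
        Nat.card {b // ChainP K lo c n b} = 1 := by
      intro lo n c
      have : Unique {b // ChainP K lo c n b} :=
        { default := ⟨Fin.elim0, fun k => k.elim0, fun k => k.elim0, fun k => k.elim0⟩
          uniq := fun x => Subsingleton.elim _ _ }
      exact ⟨inferInstance, Nat.card_unique⟩
    exact ⟨0, le_rfl, fun β n => by simpa using key _ _ _, fun β n => by simpa using key _ _ _⟩
  | succ m ih =>
    intro cm c h1 h2 h3 h4
    obtain ⟨w, hw, ha, hb⟩ := ih (c 0) (Fin.tail c) (h2 0) (fun k => h2 k.succ)
      (fun k h => by simpa using h4 h) (fun k l h => by simpa using h4 h)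
    rcases lt_or_gt_of_ne (h3 0) with h | h
    · refine ⟨w, by omega, fun β n => ?_, fun β n => ?_⟩
      · have := chain_step K cm c w hw 1 le_rfl (delta_of_gt K _ _ h1 (h2 0) h) ha β n
        simpa using this
      · have := chain_step K (-cm) (fun k => - c k) (m - w) (by omega) 0 (by omega)
          (delta_of_lt K _ _ (by simpa using h1) (by simpa using h2 0) (by simpa using h)) hb β n
        rwa [show n + 1 - 0 + (m - w) = n + (m + 1 - w) by omega] at this
    · refine ⟨w+1, by omega, fun β n => ?_, fun β n => ?_⟩
      · have := chain_step K cm c w hw 0 (by omega) (delta_of_lt K _ _ h1 (h2 0) h) ha β n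
        rwa [show n + 1 - 0 + w = n + (w + 1) by omega] at this
      · have := chain_step K (-cm) (fun k => - c k) (m - w) (by omega) 1 (by omega)
          (delta_of_gt K _ _ (by simpa using h1) (by simpa using h2 0) (by simpa using h)) hb β n
        simpa using this

def CellP {d : ℕ} (s : Fin d → ℤˣ) (σ : Equiv.Perm (Fin d)) (u : Fin d → ℤ) : Prop :=
  (∀ k, 0 < (s (σ k) : ℤ) * u (σ k)) ∧ StrictMono fun k => (s (σ k) : ℤ) * u (σ k)

lemma cell_abs {d : ℕ} {s : Fin d → ℤˣ} {σ : Equiv.Perm (Fin d)} {u : Fin d → ℤ}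
    (h : CellP s σ u) (i : Fin d) : (s i : ℤ) * u i = |u i| := by
  have := h.1 (σ.symm i)
  rw [Equiv.apply_symm_apply] at this
  rcases Int.units_eq_one_or (s i) with hs | hs
  · rw [hs] at this ⊢
    simp at this ⊢
    exact (abs_of_pos this).symm
  · rw [hs] at this ⊢
    simp at this ⊢
    exact (abs_of_neg this).symm

lemma cell_existsUnique {d : ℕ} (u : Fin d → ℤ) (h0 : ∀ i, u i ≠ 0)
    (hinj : Function.Injective fun i => |u i|) :
    ∃! q : (Fin d → ℤˣ) × Equiv.Perm (Fin d), CellP q.1 q.2 u := by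
  have hs : ∀ i, ∃ s : ℤˣ, (s : ℤ) * u i = |u i| := by
    intro i
    rcases abs_choice (u i) with h | h
    · exact ⟨1, by simp [h]⟩
    · exact ⟨-1, by simp [h]⟩
  choose s hs using hs
  refine ⟨(s, Tuple.sort fun i => |u i|), ⟨fun k => ?_, ?_⟩, ?_⟩
  · simp only [hs]; exact abs_pos.2 (h0 _)
  · simp only [hs]
    exact (Tuple.monotone_sort fun i => |u i|).strictMono_of_injective
      (hinj.comp (Equiv.injective _))
  · rintro ⟨s', σ'⟩ h
    have ha := cell_abs h
    simp only at ha h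
    refine Prod.ext (funext fun i => ?_) ?_
    · have : (s' i : ℤ) * u i = s i * u i := by rw [ha, hs]
      exact Units.ext (mul_right_cancel₀ (h0 i) this)
    · have h2 := h.2
      simp only [ha] at h2
      have := Tuple.unique_monotone (f := fun i => |u i|) (σ := σ')
        (τ := Tuple.sort fun i => |u i|) h2.monotone (Tuple.monotone_sort _)
      exact Equiv.ext fun k => hinj (congrFun this k)

def GoodP {d : ℕ} (G : SimpleGraph (Fin d)) (q : (Fin d → ℤˣ) × Equiv.Perm (Fin d)) : Prop :=
  ∀ i j, G.Adj i j → (q.1 i : ℤ) * ((q.2.symm i : ℕ) + 1) + (q.1 j : ℤ) * ((q.2.symm j : ℕ) + 1) < 0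

lemma good_iff {d : ℕ} (G : SimpleGraph (Fin d)) (s : Fin d → ℤˣ) (σ : Equiv.Perm (Fin d))
    (u : Fin d → ℤ) (h : CellP s σ u) :
    (∀ i j, G.Adj i j → u i + u j < 0) ↔ GoodP G (s, σ) := by
  refine forall_congr' fun i => forall_congr' fun j => imp_congr_right fun _ => ?_
  obtain ⟨k, rfl⟩ := σ.surjective i
  obtain ⟨l, rfl⟩ := σ.surjective j
  have hk := h.1 k
  have hl := h.1 l
  have hkl := h.2.lt_iff_lt (a := k) (b := l)
  have hlk := h.2.lt_iff_lt (a := l) (b := k)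
  simp only [Equiv.symm_apply_apply]
  simp only [Fin.lt_def] at hkl hlk
  rcases Int.units_eq_one_or (s (σ k)) with h1 | h1 <;>
  rcases Int.units_eq_one_or (s (σ l)) with h2 | h2 <;>
  simp only [h1, h2, Units.val_one, Units.val_neg, one_mul, neg_mul] at * <;> omega

def cellEquiv {d : ℕ} (K : ℤ) (n : ℕ) (e : Fin d → ℤ) (he : ∀ i, 2 * |e i| < K)
    (s : Fin d → ℤˣ) (σ : Equiv.Perm (Fin d)) :
    {y : Fin d → ℤ // (∀ i, |y i| ≤ n) ∧ CellP s σ (fun i => K * y i + e i)} ≃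
      {b // ChainP K 0 (fun k => (s (σ k) : ℤ) * e (σ k)) n b} where
  toFun y := ⟨fun k => (s (σ k) : ℤ) * y.1 (σ k), by
    obtain ⟨y, hy, h1, h2⟩ := y
    have E : ∀ k, K * ((s (σ k) : ℤ) * y (σ k)) + (s (σ k) : ℤ) * e (σ k) =
      (s (σ k) : ℤ) * (K * y (σ k) + e (σ k)) := fun k => by ring
    refine ⟨fun k => ?_, ?_, fun k => ?_⟩
    · simp only [E]; exact h1 k
    · simp only [E]; exact h2
    · refine (le_abs_self _).trans ?_
      have := hy (σ k)
      rcases Int.units_eq_one_or (s (σ k)) with h | h <;> simpa [h] using this⟩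
  invFun b := ⟨fun i => (s i : ℤ) * b.1 (σ.symm i), by
    obtain ⟨b, h1, h2, h3⟩ := b
    have E : ∀ k, (s (σ k) : ℤ) * (K * ((s (σ k) : ℤ) * b k) + e (σ k)) =
      K * b k + (s (σ k) : ℤ) * e (σ k) := fun k => by
        rcases Int.units_eq_one_or (s (σ k)) with h | h <;> simp [h] <;> ring
    refine ⟨fun i => ?_, fun k => ?_, ?_⟩
    · have : |(s i : ℤ) * b (σ.symm i)| = |b (σ.symm i)| := by
        rcases Int.units_eq_one_or (s i) with h | h <;> simp [h]
      simp only
      rw [this]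
      have hb : 0 ≤ b (σ.symm i) := by
        have := h1 (σ.symm i)
        simp only [Equiv.apply_symm_apply] at this
        have h4 : (s i : ℤ) * e i ≤ |e i| := by
          refine (le_abs_self _).trans ?_
          rcases Int.units_eq_one_or (s i) with h | h <;> simp [h]
        have := he i
        have := abs_nonneg (e i)
        by_contra hc
        have : b (σ.symm i) ≤ -1 := by omega
        nlinarith
      rw [abs_of_nonneg hb]
      exact h3 _
    · simp only [Equiv.symm_apply_apply, E]; exact h1 k
    · simp only [Equiv.symm_apply_apply, E]; exact h2⟩
  left_inv y := by
    apply Subtype.ext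
    funext i
    simp only [Equiv.apply_symm_apply]
    rcases Int.units_eq_one_or (s i) with h | h <;> simp [h]
  right_inv b := by
    apply Subtype.ext
    funext k
    simp only [Equiv.symm_apply_apply]
    rcases Int.units_eq_one_or (s (σ k)) with h | h <;> simp [h]

lemma cell_count {d : ℕ} (K : ℤ) (hK : 2 * (d + 1) = K) (s : Fin d → ℤˣ)
    (σ : Equiv.Perm (Fin d)) : ∃ w ≤ d,
    (∀ n : ℕ, Finite {y : Fin d → ℤ // (∀ i, |y i| ≤ n) ∧
        CellP s σ (fun i => K * y i + -((i : ℕ) + 1))} ∧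
      Nat.card {y : Fin d → ℤ // (∀ i, |y i| ≤ n) ∧
        CellP s σ (fun i => K * y i + -((i : ℕ) + 1))} = (n + w).choose d) ∧
    (∀ n : ℕ, Finite {y : Fin d → ℤ // (∀ i, |y i| ≤ n) ∧
        CellP s σ (fun i => K * y i + ((i : ℕ) + 1))} ∧
      Nat.card {y : Fin d → ℤ // (∀ i, |y i| ≤ n) ∧
        CellP s σ (fun i => K * y i + ((i : ℕ) + 1))} = (n + (d - w)).choose d) := by
  have ab : ∀ i, |(s i : ℤ) * -((i : ℕ) + 1 : ℤ)| = (i : ℕ) + 1 := by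
    intro i
    have : |((i : ℕ) + 1 : ℤ)| = (i : ℕ) + 1 := abs_of_pos (by positivity)
    rcases Int.units_eq_one_or (s i) with h | h <;> simp [h, this, -neg_add_rev]
  obtain ⟨w, hw, h1, h2⟩ := chain_count K d 0
    (fun k => (s (σ k) : ℤ) * -((σ k : ℕ) + 1 : ℤ)) (by simp; omega)
    (fun k => by simp only [ab]; have := (σ k).2; omega)
    (fun k hk => by
      have := ab (σ k)
      rw [hk] at this
      simp at this; omega)
    (fun k l hkl => by
      simp only at hkl
      have h1 := ab (σ k)
      rw [hkl, ab] at h1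
      apply σ.injective
      apply Fin.ext
      omega)
  have e1 := fun n => cellEquiv K n (fun i : Fin d => -((i : ℕ) + 1 : ℤ))
    (fun i => by rw [abs_neg, abs_of_pos (by positivity)]; have := i.2; omega) s σ
  have e2 := fun n => cellEquiv K n (fun i : Fin d => ((i : ℕ) + 1 : ℤ))
    (fun i => by rw [abs_of_pos (by positivity)]; have := i.2; omega) s σ
  refine ⟨w, hw, fun n => ?_, fun n => ?_⟩
  · have h := h1 0 n
    simp only [zero_add, mul_zero] at h
    rw [Nat.card_congr (e1 n)]
    have := h.1
    exact ⟨Finite.of_equiv _ (e1 n).symm, h.2⟩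
  · have h := h2 0 n
    simp only [zero_add, mul_zero, neg_zero, mul_neg, neg_neg] at h
    rw [Nat.card_congr (e2 n)]
    have := h.1
    exact ⟨Finite.of_equiv _ (e2 n).symm, h.2⟩

/-- Decomposition of the count over cells. -/
lemma count_sum {d : ℕ} (G : SimpleGraph (Fin d)) (n : ℕ) (u : (Fin d → ℤ) → (Fin d → ℤ))
    (hu0 : ∀ y i, u y i ≠ 0) (hinj : ∀ y, Function.Injective fun i => |u y i|)
    (good : Finset ((Fin d → ℤˣ) × Equiv.Perm (Fin d))) (hgood : ∀ q, q ∈ good ↔ GoodP G q)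
    (hfin : ∀ q : (Fin d → ℤˣ) × Equiv.Perm (Fin d),
      Finite {y : Fin d → ℤ // (∀ i, |y i| ≤ n) ∧ CellP q.1 q.2 (u y)}) :
    Nat.card {y : Fin d → ℤ // (∀ i, |y i| ≤ n) ∧ ∀ i j, G.Adj i j → u y i + u y j < 0} =
      ∑ q ∈ good, Nat.card {y : Fin d → ℤ // (∀ i, |y i| ≤ n) ∧ CellP q.1 q.2 (u y)} := by
  have E : {y : Fin d → ℤ // (∀ i, |y i| ≤ n) ∧ ∀ i j, G.Adj i j → u y i + u y j < 0} ≃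
      Σ q : good, {y : Fin d → ℤ // (∀ i, |y i| ≤ n) ∧ CellP q.1.1 q.1.2 (u y)} := by
    choose f hf hf' using fun y => cell_existsUnique (u y) (hu0 y) (hinj y)
    refine
      { toFun := fun y => ⟨⟨f y.1, (hgood _).2 ((good_iff G _ _ _ (hf y.1)).1 y.2.2)⟩,
          ⟨y.1, y.2.1, hf y.1⟩⟩
        invFun := fun x => ⟨x.2.1, x.2.2.1,
          (good_iff G _ _ _ x.2.2.2).2 ((hgood _).1 x.1.2)⟩
        left_inv := fun y => rfl
        right_inv := ?_ }
    rintro ⟨⟨q, hq⟩, y, hy1, hy2⟩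
    obtain rfl := hf' y q hy2
    rfl
  rw [Nat.card_congr E, Nat.card_sigma]
  exact Finset.sum_coe_sort good
    (fun q => Nat.card {y : Fin d → ℤ // (∀ i, |y i| ≤ n) ∧ CellP q.1 q.2 (u y)})

lemma mem_smul_FRAC {d : ℕ} (G : SimpleGraph (Fin d)) (hiso : ∀ i : Fin d, ∃ j, G.Adj i j)
    (m : ℕ) (x : Fin d → ℝ) :
    x ∈ (m : ℝ) • FRAC d G ↔ (∀ i, 0 ≤ x i) ∧ ∀ i j, G.Adj i j → x i + x j ≤ m := by
  rcases Nat.eq_zero_or_pos m with rfl | hm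
  · have hne : (FRAC d G).Nonempty := ⟨0, fun i => le_rfl, fun i j _ => by simp⟩
    rw [Nat.cast_zero, zero_smul_set hne, Set.mem_zero]
    constructor
    · rintro rfl
      simp
    · rintro ⟨h1, h2⟩
      funext i
      obtain ⟨j, hj⟩ := hiso i
      have := h2 i j hj
      have := h1 i
      have := h1 j
      simp only [Pi.zero_apply]
      linarith
  · have hm' : (0 : ℝ) < m := by exact_mod_cast hm
    rw [mem_smul_set_iff_inv_smul_mem₀ hm'.ne']
    simp only [FRAC, Set.mem_ofPred_eq, Pi.smul_apply, smul_eq_mul]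
    refine and_congr (forall_congr' fun i => ?_)
      (forall_congr' fun i => forall_congr' fun j => imp_congr_right fun _ => ?_)
    · exact mul_nonneg_iff_of_pos_left (inv_pos.2 hm')
    · rw [← mul_add, inv_mul_le_iff₀ hm', mul_one]

lemma latticePts_FRAC {d : ℕ} (G : SimpleGraph (Fin d)) (hiso : ∀ i : Fin d, ∃ j, G.Adj i j)
    (m h : ℕ) : latticePts ((m : ℝ) • FRAC d G) =
      Nat.card {y : Fin d → ℤ // (∀ i, -(h : ℤ) ≤ y i) ∧
        ∀ i j, G.Adj i j → y i + y j ≤ m - 2 * h} := by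
  have : ((m : ℝ) • FRAC d G) ∩ {x | ∀ i, ∃ z : ℤ, x i = (z : ℝ)} =
      (fun (y : Fin d → ℤ) (i : Fin d) => ((y i + h : ℤ) : ℝ)) ''
        {y : Fin d → ℤ | (∀ i, -(h : ℤ) ≤ y i) ∧
        ∀ i j, G.Adj i j → y i + y j ≤ m - 2 * h} := by
    ext x
    simp only [Set.mem_inter_iff, mem_smul_FRAC G hiso, Set.mem_ofPred_eq, Set.mem_image]
    constructor
    · rintro ⟨⟨h1, h2⟩, h3⟩
      choose z hz using h3
      refine ⟨fun i => z i - h, ⟨fun i => ?_, fun i j hij => ?_⟩, ?_⟩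
      · have := h1 i
        rw [hz] at this
        have : 0 ≤ z i := by exact_mod_cast this
        show _ ≤ z i - h
        omega
      · have := h2 i j hij
        rw [hz, hz] at this
        have : z i + z j ≤ m := by exact_mod_cast this
        show (z i - h) + (z j - h) ≤ _
        omega
      · funext i
        rw [hz]; simp
    · rintro ⟨y, ⟨h1, h2⟩, rfl⟩
      refine ⟨⟨fun i => ?_, fun i j hij => ?_⟩, fun i => ⟨_, rfl⟩⟩
      · have := h1 i
        have : 0 ≤ y i + h := by omega
        show (0 : ℝ) ≤ ((y i + h : ℤ) : ℝ)
        exact_mod_cast this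
      · have := h2 i j hij
        have : (y i + h) + (y j + h) ≤ m := by omega
        show ((y i + h : ℤ) : ℝ) + ((y j + h : ℤ) : ℝ) ≤ m
        exact_mod_cast this
  rw [latticePts, this, Set.ncard_image_of_injective]
  · rfl
  · intro y y' hy
    funext i
    have := congrFun hy i
    simp only [Int.cast_inj] at this
    omega

noncomputable def binPoly (d w : ℕ) : Polynomial ℚ :=
  Polynomial.C ((d.factorial : ℚ)⁻¹) *
    (descPochhammer ℚ d).comp (Polynomial.X + Polynomial.C (w : ℚ))

lemma binPoly_eval (d w n : ℕ) : (binPoly d w).eval (n : ℚ) = ((n + w).choose d : ℚ) := by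
  have : ((d.factorial : ℕ) : ℚ) ≠ 0 := by exact_mod_cast d.factorial_ne_zero
  simp only [binPoly, Polynomial.eval_mul, Polynomial.eval_C, Polynomial.eval_comp,
    Polynomial.eval_add, Polynomial.eval_X]
  rw [← Nat.cast_add, descPochhammer_eval_eq_descFactorial, Nat.descFactorial_eq_factorial_mul_choose]
  push_cast
  field_simp

lemma binPoly_eval_neg (d w n : ℕ) (hw : w ≤ d) :
    (-1) ^ d * (binPoly d w).eval (-(n : ℚ) - 1) = ((n + (d - w)).choose d : ℚ) := by
  have : ((d.factorial : ℕ) : ℚ) ≠ 0 := by exact_mod_cast d.factorial_ne_zero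
  simp only [binPoly, Polynomial.eval_mul, Polynomial.eval_C, Polynomial.eval_comp,
    Polynomial.eval_add, Polynomial.eval_X]
  have h1 := ascPochhammer_eval_neg_eq_descPochhammer ℚ (-(n : ℚ) - 1 + w) d
  have h2 := descPochhammer_eval_eq_ascPochhammer (R := ℚ) ((n + (d - w) : ℕ) : ℚ) d
  rw [show (((n + (d - w) : ℕ) : ℚ) - d + 1) = -(-(n : ℚ) - 1 + w) by
    push_cast [Nat.cast_sub hw]; ring, h1, descPochhammer_eval_eq_descFactorial,
    Nat.descFactorial_eq_factorial_mul_choose] at h2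
  rw [mul_left_comm, ← h2]
  push_cast
  field_simp

lemma binPoly_natDegree_le (d w : ℕ) : (binPoly d w).natDegree ≤ d := by
  refine (Polynomial.natDegree_C_mul_le _ _).trans ?_
  rw [Polynomial.natDegree_comp, Polynomial.natDegree_X_add_C, descPochhammer_natDegree, mul_one]

lemma binPoly_coeff (d w : ℕ) : (binPoly d w).coeff d = (d.factorial : ℚ)⁻¹ := by
  have h := (monic_descPochhammer ℚ d).comp_X_add_C (w : ℚ)
  rw [Polynomial.Monic, Polynomial.leadingCoeff, Polynomial.natDegree_comp,
    Polynomial.natDegree_X_add_C, descPochhammer_natDegree, mul_one] at h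
  rw [binPoly, Polynomial.coeff_C_mul, h, mul_one]

lemma key_inj {d : ℕ} (K : ℤ) (hK : 2 * (d + 1) = K) (y : Fin d → ℤ) (ε : ℤˣ) :
    (∀ i : Fin d, K * y i + ε * ((i : ℕ) + 1) ≠ 0) ∧
    Function.Injective fun i : Fin d => |K * y i + ε * ((i : ℕ) + 1)| := by
  have aux : ∀ t r : ℤ, |r| < K → K * t + r = 0 → r = 0 := by
    intro t r h1 h2
    refine Int.eq_zero_of_abs_lt_dvd (m := K) ⟨-t, by linarith⟩ h1
  constructor
  · intro i h
    have hi := i.2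
    have := aux _ _ (by
      rcases Int.units_eq_one_or ε with h | h <;> simp [h, -neg_add_rev] <;>
      rw [abs_of_pos (by positivity)] <;> omega) h
    rcases Int.units_eq_one_or ε with h | h <;> simp [h] at this <;> omega
  · intro i j h
    have hi := i.2
    have hj := j.2
    apply Fin.ext
    simp only at h
    rcases abs_eq_abs.1 h with h | h
    · have := aux (y i - y j) (ε * ((i : ℕ) - (j : ℕ))) (by
        rw [abs_lt]
        rcases Int.units_eq_one_or ε with h | h <;> simp [h] <;> omega) (by linarith)
      rcases Int.units_eq_one_or ε with h | h <;> simp [h] at this <;> omega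
    · have := aux (y i + y j) (ε * ((i : ℕ) + (j : ℕ) + 2)) (by
        rw [abs_lt]
        rcases Int.units_eq_one_or ε with h | h <;> simp [h] <;> omega) (by linarith)
      rcases Int.units_eq_one_or ε with h | h <;> simp [h] at this <;> omega

lemma bd_iff {d : ℕ} (G : SimpleGraph (Fin d)) (hiso : ∀ i : Fin d, ∃ j, G.Adj i j) (h : ℕ)
    (a : ℤ) (ha : a ≤ 0) (e : Fin d → ℤ) (K : ℤ)
    (hae : ∀ i j z, z ≤ a ↔ K * z + (e i + e j) < 0) (y : Fin d → ℤ) :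
    ((∀ i, -(h : ℤ) ≤ y i) ∧ ∀ i j, G.Adj i j → y i + y j ≤ a) ↔
    ((∀ i, |y i| ≤ h) ∧ ∀ i j, G.Adj i j → (K * y i + e i) + (K * y j + e j) < 0) := by
  have E : ∀ i j, y i + y j ≤ a ↔ (K * y i + e i) + (K * y j + e j) < 0 := by
    intro i j
    rw [hae i j, show K * (y i + y j) + (e i + e j) = (K * y i + e i) + (K * y j + e j) by ring]
  simp only [← E]
  constructor
  · rintro ⟨h1, h2⟩
    refine ⟨fun i => ?_, h2⟩
    obtain ⟨j, hj⟩ := hiso i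
    have := h2 i j hj
    have := h1 i
    have := h1 j
    rw [abs_le]
    omega
  · rintro ⟨h1, h2⟩
    exact ⟨fun i => (abs_le.1 (h1 i)).1, h2⟩

/-- the Ehrhart polynomial `p` of `P(G) = 2·FRAC(G)` satisfies
`#((2k+1)·FRAC(G) ∩ ℤ^d) = (−1)^d · p(−k−2)` for every `k ≥ 0`. -/
theorem stmt11 (d : ℕ) (hd : 1 ≤ d) (G : SimpleGraph (Fin d))
    (hiso : ∀ i : Fin d, ∃ j, G.Adj i j) :
    ∃ p : Polynomial ℚ, p.natDegree = d ∧
      (∀ n : ℕ, p.eval (n : ℚ) =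
        (latticePts ((n : ℝ) • ((2 : ℝ) • FRAC d G)) : ℚ)) ∧
      ∀ k : ℕ, (latticePts (((2 * k + 1 : ℕ) : ℝ) • FRAC d G) : ℚ) =
        (-1) ^ d * p.eval (-(k : ℚ) - 2) := by
  classical
  obtain ⟨K, hK⟩ : ∃ K : ℤ, 2 * ((d : ℤ) + 1) = K := ⟨_, rfl⟩
  choose w hw hw1 hw2 using fun q : (Fin d → ℤˣ) × Equiv.Perm (Fin d) => cell_count K hK q.1 q.2
  let good : Finset ((Fin d → ℤˣ) × Equiv.Perm (Fin d)) := Finset.univ.filter (GoodP G)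
  have hgood : ∀ q, q ∈ good ↔ GoodP G q := fun q => by simp [good]
  have hne : good.Nonempty := by
    refine ⟨(fun _ => -1, 1), (hgood _).2 fun i j _ => ?_⟩
    simp
    omega
  have c1 : ∀ n : ℕ, latticePts ((n : ℝ) • ((2 : ℝ) • FRAC d G)) =
      ∑ q ∈ good, (n + w q).choose d := by
    intro n
    have e : (n : ℝ) • ((2 : ℝ) • FRAC d G) = ((2 * n : ℕ) : ℝ) • FRAC d G := by
      rw [smul_smul]; push_cast; rw [mul_comm]
    rw [e, latticePts_FRAC G hiso (2 * n) n]
    rw [Nat.card_congr (Equiv.subtypeEquivRight (bd_iff G hiso n _ (by push_cast; omega)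
      (fun i => -((i : ℕ) + 1 : ℤ)) K (fun i j z => by
        have := i.2
        have := j.2
        push_cast
        constructor
        · intro hz
          have : z ≤ 0 := by linarith
          nlinarith
        · intro hz
          by_contra hc
          have : 1 ≤ z := by omega
          nlinarith)))]
    rw [count_sum G n (fun y i => K * y i + -((i : ℕ) + 1 : ℤ))
      (fun y i => by simpa using (key_inj K hK y (-1)).1 i)
      (fun y => by simpa [-neg_add_rev] using (key_inj K hK y (-1)).2) good hgood (fun q => (hw1 q n).1)]
    exact Finset.sum_congr rfl fun q _ => (hw1 q n).2
  have c2 : ∀ k : ℕ, latticePts (((2 * k + 1 : ℕ) : ℝ) • FRAC d G) =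
      ∑ q ∈ good, (k + 1 + (d - w q)).choose d := by
    intro k
    rw [latticePts_FRAC G hiso (2 * k + 1) (k + 1)]
    rw [Nat.card_congr (Equiv.subtypeEquivRight (bd_iff G hiso (k+1) _ (by push_cast; omega)
      (fun i => ((i : ℕ) + 1 : ℤ)) K (fun i j z => by
        have := i.2
        have := j.2
        push_cast
        constructor
        · intro hz
          have : z ≤ -1 := by linarith
          nlinarith
        · intro hz
          by_contra hc
          have : 0 ≤ z := by omega
          nlinarith)))]
    rw [count_sum G (k+1) (fun y i => K * y i + ((i : ℕ) + 1 : ℤ))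
      (fun y i => by simpa using (key_inj K hK y 1).1 i)
      (fun y => by simpa using (key_inj K hK y 1).2) good hgood (fun q => (hw2 q (k+1)).1)]
    exact Finset.sum_congr rfl fun q _ => (hw2 q (k+1)).2
  refine ⟨∑ q ∈ good, binPoly d (w q), ?_, fun n => ?_, fun k => ?_⟩
  · apply Polynomial.natDegree_eq_of_le_of_coeff_ne_zero
    · exact Polynomial.natDegree_sum_le_of_forall_le _ _ fun q _ => binPoly_natDegree_le _ _
    · rw [Polynomial.finsetSum_coeff]
      simp only [binPoly_coeff, Finset.sum_const, nsmul_eq_mul]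
      have : ((d.factorial : ℕ) : ℚ) ≠ 0 := by exact_mod_cast d.factorial_ne_zero
      have : ((good.card : ℕ) : ℚ) ≠ 0 := by exact_mod_cast hne.card_pos.ne'
      positivity
  · rw [Polynomial.eval_finsetSum, c1]
    simp only [binPoly_eval]
    push_cast
    rfl
  · rw [Polynomial.eval_finsetSum, c2, Finset.mul_sum]
    rw [show -(k : ℚ) - 2 = -((k + 1 : ℕ) : ℚ) - 1 by push_cast; ring]
    rw [Finset.sum_congr rfl fun q _ => binPoly_eval_neg d (w q) (k+1) (hw q)]
    push_cast
    rfl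
end

section
/- There exist polynomials p_even, p_odd ∈ ℚ[x], each of degree d, such that #(n·FRAC(G) ∩ ℤ^d) = p_even(n) for every even integer n ≥ 0 and #(n·FRAC(G) ∩ ℤ^d) = p_odd(n) for every odd integer n ≥ 1; that is, the Ehrhart counting function of FRAC(G) is a quasi-polynomial of period at most 2. Moreover, if G is bipartite, then p_even = p_odd. -/
open Set Pointwise

section helpers
open Polynomial

/-- order-type invariance -/
def OInv {d : ℕ} (P : (Fin d → ℕ) → Prop) : Prop :=
  ∀ a b : Fin d → ℕ, (∀ i j, a i < a j ↔ b i < b j) → P a → P b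

open Classical in
/-- number of maps with image `T` satisfying `P` -/
noncomputable def cnt {d : ℕ} (P : (Fin d → ℕ) → Prop) (T : Finset ℕ) : ℕ :=
  ((Fintype.piFinset (fun _ : Fin d => T)).filter
    (fun a => Finset.univ.image a = T ∧ P a)).card

open Classical in
/-- number of maps into `range N` satisfying `P` -/
noncomputable def tot {d : ℕ} (P : (Fin d → ℕ) → Prop) (N : ℕ) : ℕ :=
  ((Fintype.piFinset (fun _ : Fin d => Finset.range N)).filter P).card

lemma cnt_eq {d : ℕ} (P : (Fin d → ℕ) → Prop) (hP : OInv P) (T : Finset ℕ) :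
    cnt P T = cnt P (Finset.range T.card) := by
  classical
  have hf : ({x | x ∈ T} : Set ℕ).Finite := T.finite_toSet
  have hfc : hf.toFinset = T := by ext; simp
  have hcount : ∀ x ∈ T, Nat.count (· ∈ T) x < T.card := by
    intro x hx
    have := Nat.count_lt_card (p := (· ∈ T)) hf hx
    rwa [hfc] at this
  have hnth : ∀ k < T.card, Nat.nth (· ∈ T) k ∈ T := by
    intro k hk
    apply Nat.nth_mem_of_lt_card (p := (· ∈ T)) hf
    rwa [hfc]
  have hcn : ∀ k < T.card, Nat.count (· ∈ T) (Nat.nth (· ∈ T) k) = k := by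
    intro k hk
    apply Nat.count_nth_of_lt_card_finite (p := (· ∈ T)) hf
    rwa [hfc]
  have hnc : ∀ x ∈ T, Nat.nth (· ∈ T) (Nat.count (· ∈ T) x) = x := by
    intro x hx
    exact Nat.nth_count (p := (· ∈ T)) hx
  have hclt : ∀ x ∈ T, ∀ y ∈ T, (x < y ↔ Nat.count (· ∈ T) x < Nat.count (· ∈ T) y) := by
    intro x hx y hy
    constructor
    · intro h
      exact Nat.count_strict_mono (p := (· ∈ T)) hx h
    · intro h
      by_contra h'
      have := Nat.count_monotone (· ∈ T) (not_lt.mp h')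
      omega
  unfold cnt
  apply Finset.card_bij' (fun a _ => fun i => Nat.count (· ∈ T) (a i))
    (fun b _ => fun i => Nat.nth (· ∈ T) (b i))
  · intro a ha
    simp only [Finset.mem_filter, Fintype.mem_piFinset, Finset.mem_range] at ha ⊢
    obtain ⟨h1, h2, h3⟩ := ha
    refine ⟨fun i => hcount _ (h1 i), ?_, hP _ _ (fun i j => hclt _ (h1 i) _ (h1 j)) h3⟩
    ext k
    simp only [Finset.mem_image, Finset.mem_univ, true_and, Finset.mem_range]
    constructor
    · rintro ⟨i, rfl⟩
      exact hcount _ (h1 i)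
    · intro hk
      have hex : ∀ y ∈ T, ∃ i, a i = y := by
        intro y hy
        rw [← h2] at hy
        simpa using hy
      obtain ⟨i, hi⟩ := hex _ (hnth k hk)
      exact ⟨i, by rw [hi, hcn k hk]⟩
  · intro b hb
    simp only [Finset.mem_filter, Fintype.mem_piFinset, Finset.mem_range] at hb ⊢
    obtain ⟨h1, h2, h3⟩ := hb
    refine ⟨fun i => hnth _ (h1 i), ?_, hP _ _ (fun i j => ?_) h3⟩
    · ext x
      simp only [Finset.mem_image, Finset.mem_univ, true_and]
      constructor
      · rintro ⟨i, rfl⟩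
        exact hnth _ (h1 i)
      · intro hx
        have := Finset.mem_range.mpr (hcount x hx)
        rw [← h2] at this
        simp only [Finset.mem_image, Finset.mem_univ, true_and] at this
        obtain ⟨i, hi⟩ := this
        exact ⟨i, by rw [hi, hnc x hx]⟩
    · rw [hclt _ (hnth _ (h1 i)) _ (hnth _ (h1 j)), hcn _ (h1 i), hcn _ (h1 j)]
  · intro a ha
    simp only [Finset.mem_filter, Fintype.mem_piFinset] at ha
    funext i
    exact hnc _ (ha.1 i)
  · intro b hb
    simp only [Finset.mem_filter, Fintype.mem_piFinset, Finset.mem_range] at hb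
    funext i
    exact hcn _ (hb.1 i)

lemma tot_eq {d : ℕ} (P : (Fin d → ℕ) → Prop) (hP : OInv P) (N : ℕ) :
    tot P N = ∑ k ∈ Finset.range (d + 1), N.choose k * cnt P (Finset.range k) := by
  classical
  have h1 : tot P N = ∑ T ∈ (Finset.range N).powerset, cnt P T := by
    unfold tot
    rw [Finset.card_eq_sum_card_fiberwise (f := fun a => Finset.univ.image a)
      (t := (Finset.range N).powerset)]
    · apply Finset.sum_congr rfl
      intro T hT
      unfold cnt
      congr 1
      ext a
      simp only [Finset.mem_filter, Fintype.mem_piFinset, Finset.mem_powerset] at hT ⊢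
      constructor
      · rintro ⟨⟨h1, h2⟩, h3⟩
        exact ⟨fun i => h3 ▸ Finset.mem_image_of_mem a (Finset.mem_univ i), h3, h2⟩
      · rintro ⟨h1, h2, h3⟩
        exact ⟨⟨fun i => hT (h1 i), h3⟩, h2⟩
    · intro a ha
      simp only [Finset.coe_filter, Fintype.mem_piFinset, Set.mem_setOf_eq] at ha
      simp only [Finset.coe_powerset, Set.mem_preimage, Set.mem_powerset_iff]
      intro x hx
      simp only [Finset.coe_image, Finset.coe_univ, Set.image_univ, Set.mem_range] at hx
      obtain ⟨i, rfl⟩ := hx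
      exact ha.1 i
  have h2 : ∀ k, d < k → cnt P (Finset.range k) = 0 := by
    intro k hk
    unfold cnt
    rw [Finset.card_eq_zero, Finset.filter_eq_empty_iff]
    rintro a - ⟨h, -⟩
    have := Finset.card_image_le (s := (Finset.univ : Finset (Fin d))) (f := a)
    rw [h] at this
    simp at this
    omega
  rw [h1, Finset.sum_congr rfl (fun T _ => cnt_eq P hP T),
    Finset.sum_powerset_apply_card (fun k => cnt P (Finset.range k))]
  simp only [Finset.card_range, smul_eq_mul]
  have hA : ∀ M, N ≤ M → d ≤ M → ∑ k ∈ Finset.range (N + 1), N.choose k * cnt P (Finset.range k)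
      = ∑ k ∈ Finset.range (M + 1), N.choose k * cnt P (Finset.range k) := by
    intro M hM _
    apply Finset.sum_subset
    · intro x; simp only [Finset.mem_range]; omega
    · intro x _ hx
      rw [Nat.choose_eq_zero_of_lt (by simpa using hx), zero_mul]
  rw [hA (max N d) (le_max_left _ _) (le_max_right _ _)]
  symm
  apply Finset.sum_subset
  · intro x; simp only [Finset.mem_range]; omega
  · intro x _ hx
    rw [h2 x (by simpa using hx), mul_zero]

lemma tot_poly {d : ℕ} (P : (Fin d → ℕ) → Prop) (hP : OInv P) :
    ∃ q : ℚ[X], q.natDegree ≤ d ∧ 0 ≤ q.coeff d ∧ ∀ N : ℕ, q.eval (N : ℚ) = tot P N := by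
  refine ⟨∑ k ∈ Finset.range (d + 1),
    C ((cnt P (Finset.range k) : ℚ) / (k.factorial : ℚ)) * descPochhammer ℚ k, ?_, ?_, ?_⟩
  · apply natDegree_sum_le_of_forall_le
    intro k hk
    refine (natDegree_C_mul_le _ _).trans ?_
    rw [descPochhammer_natDegree]
    simpa [Nat.lt_succ_iff] using hk
  · rw [finset_sum_coeff]
    apply Finset.sum_nonneg
    intro k hk
    rw [coeff_C_mul]
    apply mul_nonneg (by positivity)
    rcases (Nat.lt_succ_iff.mp (Finset.mem_range.mp hk)).lt_or_eq with h | h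
    · rw [coeff_eq_zero_of_natDegree_lt]
      rwa [descPochhammer_natDegree]
    · subst h
      have := monic_descPochhammer ℚ k
      rw [Monic, leadingCoeff, descPochhammer_natDegree] at this
      rw [this]; norm_num
  · intro N
    rw [tot_eq P hP, eval_finset_sum]
    push_cast
    apply Finset.sum_congr rfl
    intro k _
    rw [eval_mul, eval_C, descPochhammer_eval_eq_descFactorial,
      Nat.descFactorial_eq_factorial_mul_choose]
    have : (k.factorial : ℚ) ≠ 0 := by positivity
    push_cast
    field_simp

/-- the edge condition -/
def ECond {d : ℕ} (G : SimpleGraph (Fin d)) (n : ℕ) (x : Fin d → ℕ) : Prop :=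
  ∀ i j, G.Adj i j → x i + x j ≤ n

lemma lattice_eq (d : ℕ) (G : SimpleGraph (Fin d)) (hiso : ∀ i : Fin d, ∃ j, G.Adj i j) (n : ℕ) :
    latticePts ((n : ℝ) • FRAC d G) = tot (ECond G n) (n + 1) := by
  classical
  have key : ((n : ℝ) • FRAC d G) =
      {x | (∀ i, 0 ≤ x i) ∧ ∀ i j, G.Adj i j → x i + x j ≤ (n : ℝ)} := by
    ext x
    rcases Nat.eq_zero_or_pos n with rfl | hn
    · have hne : (FRAC d G).Nonempty := ⟨0, by simp [FRAC]⟩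
      rw [Nat.cast_zero, Set.zero_smul_set hne]
      simp only [Set.mem_zero, Set.mem_setOf_eq]
      constructor
      · rintro rfl; simp
      · rintro ⟨h1, h2⟩
        funext i
        obtain ⟨j, hj⟩ := hiso i
        have := h2 i j hj
        have := h1 i
        have := h1 j
        simp only [Pi.zero_apply]
        linarith
    · have hn' : (0 : ℝ) < n := by exact_mod_cast hn
      rw [Set.mem_smul_set_iff_inv_smul_mem₀ hn'.ne']
      simp only [FRAC, Set.mem_setOf_eq, Pi.smul_apply, smul_eq_mul]
      refine and_congr (forall_congr' fun i => ?_) (forall_congr' fun i => forall_congr' fun j =>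
        imp_congr_right fun _ => ?_)
      · exact mul_nonneg_iff_of_pos_left (by positivity)
      · rw [← mul_add, inv_mul_le_iff₀ hn', mul_one]
  unfold latticePts tot
  rw [key, ← Set.ncard_coe_finset, ← Set.ncard_image_of_injective
    (f := fun (x : Fin d → ℕ) (i : Fin d) => ((x i : ℕ) : ℝ))]
  · congr 1
    ext x
    simp only [Set.mem_inter_iff, Set.mem_setOf_eq, Set.mem_image, Finset.coe_filter,
      Fintype.mem_piFinset, Finset.mem_range, ECond]
    constructor
    · rintro ⟨⟨h1, h2⟩, h3⟩
      choose z hz using h3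
      have hz0 : ∀ i, 0 ≤ z i := by
        intro i
        have := h1 i
        rw [hz i] at this
        exact_mod_cast this
      have hzx : ∀ i, (((z i).toNat : ℕ) : ℝ) = x i := by
        intro i
        rw [hz i]
        have := Int.toNat_of_nonneg (hz0 i)
        exact_mod_cast this
      have hE : ∀ i j, G.Adj i j → (z i).toNat + (z j).toNat ≤ n := by
        intro i j hij
        have := h2 i j hij
        rw [← hzx, ← hzx] at this
        exact_mod_cast this
      refine ⟨fun i => (z i).toNat, ⟨fun i => ?_, hE⟩, funext hzx⟩
      obtain ⟨j, hj⟩ := hiso i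
      have := hE i j hj
      show (z i).toNat < n + 1
      omega
    · rintro ⟨a, ⟨_, h2⟩, rfl⟩
      refine ⟨⟨fun i => Nat.cast_nonneg _, fun i j hij => ?_⟩, fun i => ⟨a i, by simp⟩⟩
      have := h2 i j hij
      show (a i : ℝ) + (a j : ℝ) ≤ n
      exact_mod_cast this
  · intro a b hab
    funext i
    have : (a i : ℝ) = (b i : ℝ) := congrFun hab i
    exact_mod_cast this

/-- folded condition -/
def FCond {d : ℕ} (G : SimpleGraph (Fin d)) (e : ℕ) (S : Finset (Fin d)) (a : Fin d → ℕ) : Prop :=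
  ∀ i j, G.Adj i j → i ∈ S → j ∉ S ∧ a i < a j + e

lemma FCond_inv {d : ℕ} (G : SimpleGraph (Fin d)) (e : ℕ) (he : e ≤ 1) (S : Finset (Fin d)) :
    OInv (FCond G e S) := by
  intro a b hab h i j hij hi
  obtain ⟨h1, h2⟩ := h i j hij hi
  refine ⟨h1, ?_⟩
  have := hab i j
  have := hab j i
  rcases Nat.le_one_iff_eq_zero_or_eq_one.mp he with rfl | rfl <;> omega

lemma fold_eq {d : ℕ} (G : SimpleGraph (Fin d)) (hiso : ∀ i : Fin d, ∃ j, G.Adj i j)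
    (e : ℕ) (he : e ≤ 1) (m : ℕ) :
    tot (ECond G (2 * m + e)) (2 * m + e + 1) =
      ∑ S : Finset (Fin d), tot (FCond G e S) (m + 1) := by
  classical
  conv_lhs => unfold tot
  rw [Finset.card_eq_sum_card_fiberwise
    (f := fun a : Fin d → ℕ => Finset.univ.filter (fun i => m < a i)) (t := Finset.univ)
    (by intro a _; simp)]
  apply Finset.sum_congr rfl
  intro S _
  unfold tot
  apply Finset.card_bij' (fun x _ => fun i => if i ∈ S then x i - (m + 1) else m - x i)
    (fun a _ => fun i => if i ∈ S then a i + (m + 1) else m - a i)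
  · intro x hx
    simp only [Finset.mem_filter, Fintype.mem_piFinset, Finset.mem_range] at hx ⊢
    obtain ⟨⟨h1, h2⟩, h3⟩ := hx
    have hS : ∀ i, i ∈ S ↔ m < x i := by intro i; rw [← h3]; simp
    refine ⟨fun i => ?_, fun i j hij hi => ?_⟩
    · have := h1 i
      split_ifs <;> omega
    · have := h2 i j hij
      have hi' := (hS i).1 hi
      have hj : j ∉ S := by rw [hS]; omega
      have hj' := hj
      rw [hS] at hj'
      refine ⟨hj, ?_⟩
      simp only [hi, hj, if_true, if_false]
      omega
  · intro a ha
    simp only [Finset.mem_filter, Fintype.mem_piFinset, Finset.mem_range] at ha ⊢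
    obtain ⟨h1, h2⟩ := ha
    refine ⟨⟨fun i => ?_, fun i j hij => ?_⟩, ?_⟩
    · obtain ⟨j, hj⟩ := hiso i
      have := h1 i
      have := h1 j
      split_ifs with hi
      · have := (h2 i j hj hi).2
        omega
      · omega
    · have := h1 i
      have := h1 j
      by_cases hi : i ∈ S
      · obtain ⟨hj, h⟩ := h2 i j hij hi
        simp only [hi, hj, if_true, if_false]
        omega
      · by_cases hj : j ∈ S
        · obtain ⟨_, h⟩ := h2 j i hij.symm hj
          simp only [hi, hj, if_true, if_false]
          omega
        · simp only [hi, hj, if_false]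
          omega
    · ext i
      simp only [Finset.mem_filter, Finset.mem_univ, true_and]
      split_ifs with hi
      · simp only [hi, iff_true]; omega
      · simp only [hi, iff_false]; omega
  · intro x hx
    simp only [Finset.mem_filter, Fintype.mem_piFinset, Finset.mem_range] at hx
    obtain ⟨⟨h1, h2⟩, h3⟩ := hx
    have hS : ∀ i, i ∈ S ↔ m < x i := by intro i; rw [← h3]; simp
    funext i
    have := hS i
    by_cases hi : i ∈ S
    · have := this.1 hi
      simp only [hi, if_true]; omega
    · have : ¬ m < x i := fun h => hi (this.2 h)
      simp only [hi, if_false]; omega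
  · intro a ha
    simp only [Finset.mem_filter, Fintype.mem_piFinset, Finset.mem_range] at ha
    funext i
    have := ha.1 i
    by_cases hi : i ∈ S
    · simp only [hi, if_true]; omega
    · simp only [hi, if_false]; omega

lemma fold_poly {d : ℕ} (G : SimpleGraph (Fin d)) (hiso : ∀ i : Fin d, ∃ j, G.Adj i j)
    (e : ℕ) (he : e ≤ 1) :
    ∃ q : ℚ[X], q.natDegree = d ∧ ∀ m : ℕ, q.eval ((m : ℚ) + 1) =
      (latticePts (((2 * m + e : ℕ) : ℝ) • FRAC d G) : ℚ) := by
  classical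
  choose q hq1 hq2 hq3 using fun S : Finset (Fin d) => tot_poly _ (FCond_inv G e he S)
  have h0 : q ∅ = X ^ d := by
    apply eq_of_infinite_eval_eq
    apply Set.Infinite.mono _ (Set.infinite_range_of_injective (Nat.cast_injective (R := ℚ)))
    rintro _ ⟨N, rfl⟩
    simp only [Set.mem_setOf_eq, hq3, eval_pow, eval_X]
    have : tot (FCond G e ∅) N = N ^ d := by
      unfold tot
      rw [Finset.filter_true_of_mem (by intro a _ i j _ h; simp at h)]
      simp
    rw [this]; push_cast; rfl
  have hle : (∑ S, q S).natDegree ≤ d := natDegree_sum_le_of_forall_le _ _ (fun S _ => hq1 S)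
  have hpos : 0 < (∑ S, q S).coeff d := by
    rw [finset_sum_coeff]
    refine Finset.sum_pos' (fun S _ => hq2 S) ⟨∅, Finset.mem_univ _, ?_⟩
    rw [h0]; simp
  refine ⟨∑ S, q S, le_antisymm hle (le_natDegree_of_ne_zero hpos.ne'), fun m => ?_⟩
  rw [lattice_eq d G hiso, fold_eq G hiso e he, eval_finset_sum]
  push_cast
  apply Finset.sum_congr rfl
  intro S _
  have := hq3 S (m + 1)
  push_cast at this
  exact this

/-- order condition, bipartite case -/
def BCond {d : ℕ} (G : SimpleGraph (Fin d)) (c : Fin d → Fin 2) (a : Fin d → ℕ) : Prop :=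
  ∀ i j, G.Adj i j → c i = 0 → a i ≤ a j

lemma bip_poly {d : ℕ} (G : SimpleGraph (Fin d)) (hiso : ∀ i : Fin d, ∃ j, G.Adj i j)
    (hG : G.Colorable 2) :
    ∃ q : ℚ[X], ∀ n : ℕ, q.eval (n : ℚ) = (latticePts ((n : ℝ) • FRAC d G) : ℚ) := by
  classical
  obtain ⟨c⟩ := hG
  have hc : ∀ i j, G.Adj i j → c i ≠ c j := fun i j h => c.valid h
  have hinv : OInv (BCond G c) := by
    intro a b hab h i j hij hi
    have := h i j hij hi
    have := hab j i
    omega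
  obtain ⟨q, -, -, hq⟩ := tot_poly _ hinv
  refine ⟨q.comp (X + 1), fun n => ?_⟩
  have h1 := hq (n + 1)
  push_cast at h1
  rw [eval_comp]
  simp only [eval_add, eval_X, eval_one]
  rw [h1, lattice_eq d G hiso]
  congr 1
  symm
  unfold tot
  apply Finset.card_bij' (fun x _ => fun i => if c i = 0 then x i else n - x i)
    (fun x _ => fun i => if c i = 0 then x i else n - x i)
  · intro x hx
    simp only [Finset.mem_filter, Fintype.mem_piFinset, Finset.mem_range] at hx ⊢
    obtain ⟨h1, h2⟩ := hx
    refine ⟨fun i => ?_, fun i j hij hi => ?_⟩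
    · have := h1 i
      split_ifs <;> omega
    · have hj : c j ≠ 0 := fun h => hc i j hij (hi.trans h.symm)
      have := h2 i j hij
      simp only [hi, hj, if_true, if_false]
      omega
  · intro x hx
    simp only [Finset.mem_filter, Fintype.mem_piFinset, Finset.mem_range] at hx ⊢
    obtain ⟨h1, h2⟩ := hx
    refine ⟨fun i => ?_, fun i j hij => ?_⟩
    · have := h1 i
      split_ifs <;> omega
    · have := h1 i
      have := h1 j
      by_cases hi : c i = 0
      · have hj : c j ≠ 0 := fun h => hc i j hij (hi.trans h.symm)
        have := h2 i j hij hi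
        simp only [hi, hj, if_true, if_false]
        omega
      · have hj : c j = 0 := by
          have := hc i j hij
          omega
        have := h2 j i hij.symm hj
        simp only [hi, hj, if_true, if_false]
        omega
  · intro x hx
    simp only [Finset.mem_filter, Fintype.mem_piFinset, Finset.mem_range] at hx
    funext i
    have := hx.1 i
    by_cases hi : c i = 0
    · simp only [hi, if_true]
    · simp only [hi, if_false]; omega
  · intro x hx
    simp only [Finset.mem_filter, Fintype.mem_piFinset, Finset.mem_range] at hx
    funext i
    have := hx.1 i
    by_cases hi : c i = 0
    · simp only [hi, if_true]
    · simp only [hi, if_false]; omega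

end helpers

/-- the Ehrhart counting function of `FRAC(G)` is a quasi-polynomial
of degree `d` and period at most 2; if `G` is bipartite the two constituents agree. -/
theorem stmt12 (d : ℕ) (hd : 1 ≤ d) (G : SimpleGraph (Fin d))
    (hiso : ∀ i : Fin d, ∃ j, G.Adj i j) :
    ∃ pe po : Polynomial ℚ, pe.natDegree = d ∧ po.natDegree = d ∧
      (∀ n : ℕ, Even n → pe.eval (n : ℚ) = (latticePts ((n : ℝ) • FRAC d G) : ℚ)) ∧
      (∀ n : ℕ, Odd n → po.eval (n : ℚ) = (latticePts ((n : ℝ) • FRAC d G) : ℚ)) ∧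
      (G.Colorable 2 → pe = po) := by
  obtain ⟨q0, hd0, h0⟩ := fold_poly G hiso 0 (by norm_num)
  obtain ⟨q1, hd1, h1⟩ := fold_poly G hiso 1 le_rfl
  have hE : ∀ n : ℕ, Even n → (q0.comp (Polynomial.C (1/2) * Polynomial.X + Polynomial.C 1)).eval (n : ℚ)
      = (latticePts ((n : ℝ) • FRAC d G) : ℚ) := by
    rintro n ⟨m, rfl⟩
    have := h0 m
    rw [show 2 * m + 0 = m + m by ring] at this
    rw [← this, Polynomial.eval_comp]
    congr 1
    simp only [Polynomial.eval_add, Polynomial.eval_mul, Polynomial.eval_C, Polynomial.eval_X]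
    push_cast; ring
  have hO : ∀ n : ℕ, Odd n → (q1.comp (Polynomial.C (1/2) * Polynomial.X + Polynomial.C (1/2))).eval (n : ℚ)
      = (latticePts ((n : ℝ) • FRAC d G) : ℚ) := by
    rintro n ⟨m, rfl⟩
    rw [← h1 m, Polynomial.eval_comp]
    congr 1
    simp only [Polynomial.eval_add, Polynomial.eval_mul, Polynomial.eval_C, Polynomial.eval_X]
    push_cast; ring
  refine ⟨_, _, ?_, ?_, hE, hO, ?_⟩
  · rw [Polynomial.natDegree_comp, Polynomial.natDegree_linear (by norm_num), hd0, mul_one]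
  · rw [Polynomial.natDegree_comp, Polynomial.natDegree_linear (by norm_num), hd1, mul_one]
  · intro hG
    obtain ⟨q, hq⟩ := bip_poly G hiso hG
    trans q
    · apply Polynomial.eq_of_infinite_eval_eq
      apply Set.Infinite.mono _ (Set.infinite_range_of_injective
        (f := fun m : ℕ => ((2 * m : ℕ) : ℚ)) (by
          intro a b h
          beta_reduce at h
          have : 2 * a = 2 * b := by exact_mod_cast h
          omega))
      rintro _ ⟨m, rfl⟩
      simp only [Set.mem_setOf_eq]
      rw [hE _ (even_two_mul m), hq]
    · symm
      apply Polynomial.eq_of_infinite_eval_eq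
      apply Set.Infinite.mono _ (Set.infinite_range_of_injective
        (f := fun m : ℕ => ((2 * m + 1 : ℕ) : ℚ)) (by
          intro a b h
          beta_reduce at h
          have : 2 * a + 1 = 2 * b + 1 := by exact_mod_cast h
          omega))
      rintro _ ⟨m, rfl⟩
      simp only [Set.mem_setOf_eq]
      rw [hO _ (odd_two_mul_add_one m), hq]
end

section
/- Let A ⊂ ℤ^{d+1} be the finite set consisting of the vector (0,…,0,1), the vectors (e_i + e_j, 1) for all edges (i,j) ∈ E(G), and the vectors (−e_i, 1) for 1 ≤ i ≤ d. Then G is bipartite if and only if every lattice point of ℤ^{d+1} that is a nonnegative rational linear combination of elements of A is also a nonnegative integer linear combination of elements of A (i.e., ℤ_{≥0}A = ℚ_{≥0}A ∩ ℤ^{d+1}); equivalently, the dual polytope Q(G)^∨ is a normal lattice polytope. -/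
open Set Pointwise

abbrev IntQ : AddSubgroup ℚ := (Int.castAddHom ℚ).range

def NN {V E : Type} [DecidableEq V] (src tgt : E → V) (e : E) (v : V) : ℚ :=
  (if src e = v then 1 else 0) - (if tgt e = v then 1 else 0)

lemma NN_cases {V E : Type} [DecidableEq V] (src tgt : E → V) (e : E) (v : V)
    (h : NN src tgt e v ≠ 0) : NN src tgt e v = 1 ∨ NN src tgt e v = -1 := by
  unfold NN at *
  split_ifs at * <;> simp_all

lemma NN_mem {V E : Type} [DecidableEq V] (src tgt : E → V) (e : E) (v : V)
    (h : NN src tgt e v ≠ 0) : v = src e ∨ v = tgt e := by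
  unfold NN at *
  split_ifs at * <;> simp_all

lemma mul_NN_int {V E : Type} [DecidableEq V] (src tgt : E → V) (e : E) (v : V) (q : ℚ)
    (h : q ∈ IntQ) : q * NN src tgt e v ∈ IntQ := by
  by_cases h0 : NN src tgt e v = 0
  · rw [h0, mul_zero]; exact zero_mem _
  · rcases NN_cases src tgt e v h0 with h1 | h1 <;> rw [h1]
    · simpa using h
    · simpa using neg_mem h

lemma int_of_mul_NN {V E : Type} [DecidableEq V] (src tgt : E → V) (e : E) (v : V) (q : ℚ)
    (h0 : NN src tgt e v ≠ 0) (h : q * NN src tgt e v ∈ IntQ) : q ∈ IntQ := by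
  rcases NN_cases src tgt e v h0 with h1 | h1 <;> rw [h1] at h
  · simpa using h
  · have := neg_mem h
    simpa using this

open Classical in
lemma exists_dir {V E : Type} [Fintype V] [Fintype E] [DecidableEq V]
    (src tgt : E → V) (hne : ∀ e, src e ≠ tgt e) (f : E → ℚ)
    (hb : ∀ v, ∑ e, f e * NN src tgt e v ∈ IntQ) (hF : ∃ e, f e ∉ IntQ) :
    ∃ δ : E → ℚ, δ ≠ 0 ∧ (∀ e, f e ∈ IntQ → δ e = 0) ∧
      (∀ v, ∑ e, δ e * NN src tgt e v = 0) ∧ ∑ e, δ e ≤ 0 := by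
  set F : Finset E := Finset.univ.filter (fun e => f e ∉ IntQ) with hFdef
  set W : Finset V := Finset.univ.filter (fun v => ∃ e ∈ F, NN src tgt e v ≠ 0) with hW
  have hdeg : ∀ v ∈ W, 2 ≤ (F.filter (fun e => NN src tgt e v ≠ 0)).card := by
    intro v hv
    obtain ⟨e, he, hev⟩ := (Finset.mem_filter.1 hv).2
    by_contra hlt
    apply (Finset.mem_filter.1 he).2
    apply int_of_mul_NN src tgt e v _ hev
    have h1 := hb v
    rw [← Finset.add_sum_erase _ _ (Finset.mem_univ e)] at h1
    refine (AddSubgroup.add_mem_cancel_right _ ?_).1 h1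
    apply sum_mem
    intro e' he'
    by_cases hi : f e' ∈ IntQ
    · exact mul_NN_int _ _ _ _ _ hi
    · by_cases h0 : NN src tgt e' v = 0
      · rw [h0, mul_zero]; exact zero_mem _
      · exfalso
        apply hlt
        have : 1 < (F.filter (fun e => NN src tgt e v ≠ 0)).card := by
          rw [Finset.one_lt_card]
          refine ⟨e, by simp [he, hev], e', ?_, fun h => (Finset.mem_erase.1 he').1 h.symm⟩
          simp only [Finset.mem_filter]
          exact ⟨Finset.mem_filter.2 ⟨Finset.mem_univ _, hi⟩, h0⟩
        exact this
  have hcard : W.card ≤ F.card := by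
    have h1 : ∑ v ∈ W, (F.filter (fun e => NN src tgt e v ≠ 0)).card
        = ∑ e ∈ F, (W.filter (fun v => NN src tgt e v ≠ 0)).card :=
      (Finset.sum_card_bipartiteAbove_eq_sum_card_bipartiteBelow
        (fun e v => NN src tgt e v ≠ 0)).symm
    have h2 : W.card * 2 ≤ ∑ v ∈ W, (F.filter (fun e => NN src tgt e v ≠ 0)).card := by
      simpa using Finset.card_nsmul_le_sum W _ 2 hdeg
    have h3 : ∑ e ∈ F, (W.filter (fun v => NN src tgt e v ≠ 0)).card ≤ F.card * 2 := by
      have := Finset.sum_le_card_nsmul F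
        (fun e => (W.filter (fun v => NN src tgt e v ≠ 0)).card) 2 ?_
      · simpa using this
      · intro e _
        refine (Finset.card_le_card (t := {src e, tgt e}) ?_).trans Finset.card_le_two
        intro v hv
        have := NN_mem src tgt e v (Finset.mem_filter.1 hv).2
        simpa using this
    omega
  let D : (F → ℚ) →ₗ[ℚ] (W → ℚ) :=
    { toFun := fun δ v => ∑ e, δ e * NN src tgt e v
      map_add' := by
        intro a b; ext v; simp [add_mul, Finset.sum_add_distrib]
      map_smul' := by
        intro a b; ext v; simp [Finset.mul_sum, mul_assoc] }
  have hNW : ∀ e ∈ F, ∑ v : W, NN src tgt e v = 0 := by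
    intro e he
    rw [Finset.sum_coe_sort W (fun v => NN src tgt e v)]
    rw [Finset.sum_subset (Finset.subset_univ W)]
    · simp [NN]
    · intro v _ hv
      by_contra h0
      exact hv (Finset.mem_filter.2 ⟨Finset.mem_univ _, e, he, h0⟩)
  have hDsum : ∀ δ, ∑ v, D δ v = 0 := by
    intro δ
    change ∑ v : W, ∑ e : F, δ e * NN src tgt e v = 0
    rw [Finset.sum_comm]
    apply Finset.sum_eq_zero
    intro e _
    rw [← Finset.mul_sum, hNW e e.2, mul_zero]
  have hnotinj : ¬ Function.Injective D := by
    intro hinj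
    have hle := LinearMap.finrank_le_finrank_of_injective hinj
    have heq : Module.finrank ℚ (F → ℚ) = Module.finrank ℚ (W → ℚ) := by
      apply le_antisymm hle
      simpa using hcard
    have hsur := (LinearMap.injective_iff_surjective_of_finrank_eq_finrank heq).1 hinj
    obtain ⟨e, he⟩ := hF
    have heF : e ∈ F := Finset.mem_filter.2 ⟨Finset.mem_univ _, he⟩
    have hvW : src e ∈ W := Finset.mem_filter.2 ⟨Finset.mem_univ _, e, heF, by
      simp [NN, (hne e).symm]⟩
    obtain ⟨δ, hδ⟩ := hsur (Pi.single ⟨src e, hvW⟩ 1)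
    have := hDsum δ
    rw [hδ] at this
    simp at this
  obtain ⟨δ, hδ0, hδ⟩ : ∃ δ, D δ = 0 ∧ δ ≠ 0 := by
    by_contra hcon
    push Not at hcon
    exact hnotinj ((injective_iff_map_eq_zero D).2 hcon)
  have key : ∃ δ : E → ℚ, δ ≠ 0 ∧ (∀ e, f e ∈ IntQ → δ e = 0) ∧
      (∀ v, ∑ e, δ e * NN src tgt e v = 0) := by
    refine ⟨fun e => if h : e ∈ F then δ ⟨e, h⟩ else 0, ?_, ?_, ?_⟩
    · intro h
      apply hδ
      ext e
      have := congrFun h e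
      simpa using this
    · intro e he
      have : e ∉ F := fun h => (Finset.mem_filter.1 h).2 he
      simp [this]
    · intro v
      have h1 : ∑ e, (if h : e ∈ F then δ ⟨e, h⟩ else 0) * NN src tgt e v
          = ∑ e : F, δ e * NN src tgt e v := by
        rw [← Finset.sum_subset (Finset.subset_univ F)]
        · rw [← Finset.sum_coe_sort F]
          apply Finset.sum_congr rfl
          intro e _
          simp
        · intro e _ he
          simp [he]
      rw [h1]
      by_cases hv : v ∈ W
      · exact congrFun hδ0 ⟨v, hv⟩
      · apply Finset.sum_eq_zero
        intro e _
        have : NN src tgt e v = 0 := by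
          by_contra h0
          exact hv (Finset.mem_filter.2 ⟨Finset.mem_univ _, e, e.2, h0⟩)
        rw [this, mul_zero]
  obtain ⟨δ, h1, h2, h3⟩ := key
  by_cases hs : ∑ e, δ e ≤ 0
  · exact ⟨δ, h1, h2, h3, hs⟩
  · refine ⟨-δ, by simpa using h1, ?_, ?_, ?_⟩
    · intro e he; simp [h2 e he]
    · intro v; simp [h3 v]
    · simp; linarith

lemma step_exists (x δ : ℚ) (hx : x ∉ IntQ) (hδ : δ ≠ 0) :
    ∃ t : ℚ, 0 < t ∧ x + t * δ ∈ IntQ ∧ ∀ s, 0 ≤ s → s ≤ t → (⌊x⌋ : ℚ) ≤ x + s * δ := by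
  rcases lt_or_gt_of_ne hδ with h | h
  · have hlt : (⌊x⌋ : ℚ) < x := lt_of_le_of_ne (Int.floor_le x) (fun he => hx ⟨⌊x⌋, he⟩)
    refine ⟨(x - ⌊x⌋) / (-δ), div_pos (by linarith) (by linarith), ⟨⌊x⌋, ?_⟩, ?_⟩
    · have : (x - ⌊x⌋) / (-δ) * δ = -(x - ⌊x⌋) := by field_simp
      rw [this]; simp only [Int.coe_castAddHom]; ring
    · intro s _ hs
      rw [le_div_iff₀ (by linarith)] at hs
      linarith
  · have hlt : x < (⌊x⌋ : ℚ) + 1 := Int.lt_floor_add_one x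
    refine ⟨(⌊x⌋ + 1 - x) / δ, div_pos (by linarith) h, ⟨⌊x⌋ + 1, ?_⟩, ?_⟩
    · simp; field_simp; ring
    · intro s h0 _
      have := Int.floor_le x
      nlinarith

open Classical in
lemma net {V E : Type} [Fintype V] [Fintype E] [DecidableEq V]
    (src tgt : E → V) (hne : ∀ e, src e ≠ tgt e) (n : ℕ) : ∀ (f : E → ℚ), (∀ e, 0 ≤ f e) →
    (∀ v, ∑ e, f e * NN src tgt e v ∈ IntQ) →
    (Finset.univ.filter (fun e => f e ∉ IntQ)).card = n →
    ∃ g : E → ℕ, (∀ v, ∑ e, (g e : ℚ) * NN src tgt e v = ∑ e, f e * NN src tgt e v) ∧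
      ∑ e, (g e : ℚ) ≤ ∑ e, f e := by
  induction n using Nat.strong_induction_on with
  | _ n ih =>
  intro f hf hb hn
  by_cases hF : ∃ e, f e ∉ IntQ
  · obtain ⟨δ, h1, h2, h3, h4⟩ := exists_dir src tgt hne f hb hF
    have hst : ∀ e, δ e ≠ 0 → ∃ t : ℚ, 0 < t ∧ f e + t * δ e ∈ IntQ ∧
        ∀ s, 0 ≤ s → s ≤ t → (⌊f e⌋ : ℚ) ≤ f e + s * δ e := by
      intro e he
      exact step_exists _ _ (fun h => he (h2 e h)) he
    choose! t ht0 htI htf using hst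
    have hne' : (Finset.univ.filter (fun e => δ e ≠ 0)).Nonempty := by
      obtain ⟨e, he⟩ := Function.ne_iff.1 h1
      exact ⟨e, by simpa using he⟩
    obtain ⟨e0, he0, hmin⟩ := Finset.exists_min_image _ t hne'
    have he0' : δ e0 ≠ 0 := (Finset.mem_filter.1 he0).2
    have hT := ht0 e0 he0'
    have hbal : ∀ v, ∑ e, (f e + t e0 * δ e) * NN src tgt e v = ∑ e, f e * NN src tgt e v := by
      intro v
      simp only [add_mul, Finset.sum_add_distrib, mul_assoc]
      rw [← Finset.mul_sum, h3 v]; simp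
    have hcost : ∑ e, (f e + t e0 * δ e) ≤ ∑ e, f e := by
      rw [Finset.sum_add_distrib, ← Finset.mul_sum]
      nlinarith
    have hlt : (Finset.univ.filter (fun e => f e + t e0 * δ e ∉ IntQ)).card < n := by
      rw [← hn]
      apply Finset.card_lt_card
      rw [Finset.ssubset_iff_of_subset]
      · refine ⟨e0, ?_, ?_⟩
        · exact Finset.mem_filter.2 ⟨Finset.mem_univ _, fun h => he0' (h2 e0 h)⟩
        · intro h
          exact (Finset.mem_filter.1 h).2 (htI e0 he0')
      · intro e he
        refine Finset.mem_filter.2 ⟨Finset.mem_univ _, fun h => (Finset.mem_filter.1 he).2 ?_⟩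
        simpa only [h2 e h, mul_zero, add_zero] using h
    have hnn : ∀ e, 0 ≤ f e + t e0 * δ e := by
      intro e
      by_cases hd : δ e = 0
      · simp [hd, hf e]
      · have := htf e hd (t e0) hT.le (hmin e (by simpa using hd))
        have h0 : (0:ℚ) ≤ (⌊f e⌋ : ℚ) := by
          exact_mod_cast Int.floor_nonneg.2 (hf e)
        exact h0.trans this
    obtain ⟨g, hg1, hg2⟩ := ih _ hlt (fun e => f e + t e0 * δ e) hnn
      (fun v => by rw [hbal v]; exact hb v) rfl
    exact ⟨g, fun v => (hg1 v).trans (hbal v), hg2.trans hcost⟩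
  · push Not at hF
    have : ∀ e, ∃ k : ℕ, (k : ℚ) = f e := by
      intro e
      obtain ⟨z, hz⟩ := hF e
      have hz : (z : ℚ) = f e := hz
      have h0 : 0 ≤ z := by
        have := hf e
        rw [← hz] at this
        exact_mod_cast this
      refine ⟨z.toNat, ?_⟩
      rw [← hz]
      exact_mod_cast Int.toNat_of_nonneg h0
    choose g hg using this
    exact ⟨g, by simp [hg], by simp [hg]⟩

abbrev EE {d : ℕ} (G : SimpleGraph (Fin d)) (col : Fin d → Fin 2) : Type :=
  {p : Fin d × Fin d // G.Adj p.1 p.2 ∧ col p.1 = 0} ⊕ Fin d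

def vecE {d : ℕ} (G : SimpleGraph (Fin d)) (col : Fin d → Fin 2) :
    EE G col → Fin (d + 1) → ℤ
  | Sum.inl p => Fin.snoc (Pi.single p.1.1 1 + Pi.single p.1.2 1) (1 : ℤ)
  | Sum.inr i => Fin.snoc (-Pi.single i 1) (1 : ℤ)

def srcE {d : ℕ} (G : SimpleGraph (Fin d)) (col : Fin d → Fin 2) :
    EE G col → Option (Fin d)
  | Sum.inl p => some p.1.1
  | Sum.inr i => if col i = 0 then none else some i

def tgtE {d : ℕ} (G : SimpleGraph (Fin d)) (col : Fin d → Fin 2) :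
    EE G col → Option (Fin d)
  | Sum.inl p => some p.1.2
  | Sum.inr i => if col i = 0 then some i else none

lemma srcE_ne {d : ℕ} (G : SimpleGraph (Fin d)) (col : Fin d → Fin 2) (e : EE G col) :
    srcE G col e ≠ tgtE G col e := by
  rcases e with p | i
  · simpa [srcE, tgtE] using p.2.1.ne
  · simp only [srcE, tgtE]
    split_ifs <;> simp

lemma vecE_last {d : ℕ} (G : SimpleGraph (Fin d)) (col : Fin d → Fin 2) (e : EE G col) :
    vecE G col e (Fin.last d) = 1 := by
  rcases e with p | i <;> simp [vecE]

lemma vecE_mem {d : ℕ} (G : SimpleGraph (Fin d)) (col : Fin d → Fin 2) (e : EE G col) :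
    vecE G col e ∈ Aset d G := by
  rcases e with p | i
  · exact Or.inr (Or.inl ⟨_, _, p.2.1, rfl⟩)
  · exact Or.inr (Or.inr ⟨_, rfl⟩)

def sgnE {d : ℕ} (col : Fin d → Fin 2) (i : Fin d) : ℤ := if col i = 0 then 1 else -1

lemma sgnE_sq {d : ℕ} (col : Fin d → Fin 2) (i : Fin d) : sgnE col i * sgnE col i = 1 := by
  unfold sgnE; split_ifs <;> simp

lemma NN_vecE {d : ℕ} (G : SimpleGraph (Fin d)) (col : Fin d → Fin 2)
    (hcol : ∀ i j, G.Adj i j → col i ≠ col j) (e : EE G col) (i : Fin d) :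
    NN (srcE G col) (tgtE G col) e (some i)
      = (sgnE col i : ℚ) * (vecE G col e (Fin.castSucc i) : ℚ) := by
  rcases e with ⟨⟨a, b⟩, hab, ha⟩ | k
  · have hb : col b ≠ 0 := by
      have := hcol _ _ hab
      simp only at ha
      rw [ha] at this
      exact this.symm
    have hne : a ≠ b := hab.ne
    simp only at ha
    simp only [NN, srcE, tgtE, vecE, sgnE, Fin.snoc_castSucc, Pi.add_apply, Pi.single_apply,
      Option.some.injEq]
    by_cases h1 : i = a
    · subst h1
      simp [ha, hne, hne.symm]
    · by_cases h2 : i = b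
      · subst h2
        simp [hb, hne, hne.symm]
      · simp [h1, h2, Ne.symm h1, Ne.symm h2]
  · simp only [NN, srcE, tgtE, vecE, sgnE, Fin.snoc_castSucc, Pi.neg_apply, Pi.single_apply]
    by_cases h1 : i = k
    · subst h1
      by_cases h : col i = 0 <;> simp [h]
    · by_cases h : col k = 0 <;> simp [h, h1, Ne.symm h1]

abbrev zvec (d : ℕ) : Fin (d + 1) → ℤ := Fin.snoc (0 : Fin d → ℤ) (1 : ℤ)

open Classical in
def PP {d : ℕ} (G : SimpleGraph (Fin d)) (col : Fin d → Fin 2) (w : Fin (d + 1) → ℚ) : Prop :=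
  ∃ (f : EE G col → ℚ) (c : ℚ), (∀ e, 0 ≤ f e) ∧ 0 ≤ c ∧
    ∀ i, w i = ∑ e, f e * (vecE G col e i : ℚ) + c * (zvec d i : ℚ)

open Classical in
lemma PP_add {d : ℕ} (G : SimpleGraph (Fin d)) (col : Fin d → Fin 2) (w w' : Fin (d + 1) → ℚ)
    (h : PP G col w) (h' : PP G col w') : PP G col (w + w') := by
  obtain ⟨f, c, hf, hc, hw⟩ := h
  obtain ⟨f', c', hf', hc', hw'⟩ := h'
  refine ⟨f + f', c + c', fun e => add_nonneg (hf e) (hf' e), add_nonneg hc hc', fun i => ?_⟩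
  simp only [Pi.add_apply, hw, hw', add_mul, Finset.sum_add_distrib]
  ring

open Classical in
lemma PP_vec {d : ℕ} (G : SimpleGraph (Fin d)) (col : Fin d → Fin 2) (e : EE G col) (q : ℚ)
    (hq : 0 ≤ q) : PP G col (fun i => q * (vecE G col e i : ℚ)) := by
  refine ⟨Pi.single e q, 0, fun e' => ?_, le_rfl, fun i => ?_⟩
  · by_cases h : e' = e
    · subst h; simpa using hq
    · simp [h]
  · simp [Pi.single_apply]

open Classical in
lemma PP_A {d : ℕ} (G : SimpleGraph (Fin d)) (col : Fin d → Fin 2)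
    (hcol : ∀ i j, G.Adj i j → col i ≠ col j) (a : Fin (d + 1) → ℤ) (ha : a ∈ Aset d G) (q : ℚ)
    (hq : 0 ≤ q) : PP G col (fun i => q * (a i : ℚ)) := by
  rcases ha with rfl | ⟨i, j, hij, rfl⟩ | ⟨i, rfl⟩
  · exact ⟨0, q, by simp, hq, by simp⟩
  · by_cases hi : col i = 0
    · exact PP_vec G col (Sum.inl ⟨(i, j), hij, hi⟩) q hq
    · have hj : col j = 0 := by
        have := hcol _ _ hij
        omega
      have h := PP_vec G col (Sum.inl ⟨(j, i), hij.symm, hj⟩) q hq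
      simp only [vecE] at h
      have hc : (Pi.single j 1 + Pi.single i 1 : Fin d → ℤ) = Pi.single i 1 + Pi.single j 1 :=
        add_comm _ _
      rwa [hc] at h
  · exact PP_vec G col (Sum.inr i) q hq

open Classical in
lemma forward {d : ℕ} (G : SimpleGraph (Fin d)) (col : Fin d → Fin 2)
    (hcol : ∀ i j, G.Adj i j → col i ≠ col j) (u : Fin (d + 1) → ℤ)
    (h : PP G col (fun i => (u i : ℚ))) : u ∈ AddSubmonoid.closure (Aset d G) := by
  obtain ⟨f, c, hf, hc, hw⟩ := h
  beta_reduce at hw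
  have hs : ∀ (f : EE G col → ℚ) (i : Fin d),
      ∑ e, f e * NN (srcE G col) (tgtE G col) e (some i)
      = (sgnE col i : ℚ) * ∑ e, f e * (vecE G col e (Fin.castSucc i) : ℚ) := by
    intro f i
    rw [Finset.mul_sum]
    apply Finset.sum_congr rfl
    intro e _
    rw [NN_vecE G col hcol]; ring
  have hu : ∀ i : Fin d, (u (Fin.castSucc i) : ℚ)
      = ∑ e, f e * (vecE G col e (Fin.castSucc i) : ℚ) := by
    intro i
    rw [hw]; simp [zvec]
  have hsome : ∀ i : Fin d, ∑ e, f e * NN (srcE G col) (tgtE G col) e (some i) ∈ IntQ := by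
    intro i
    rw [hs, ← hu]
    exact ⟨sgnE col i * u (Fin.castSucc i), by simp⟩
  have htot : ∑ v, ∑ e, f e * NN (srcE G col) (tgtE G col) e v = 0 := by
    rw [Finset.sum_comm]
    apply Finset.sum_eq_zero
    intro e _
    rw [← Finset.mul_sum]
    simp [NN]
  have hb : ∀ v, ∑ e, f e * NN (srcE G col) (tgtE G col) e v ∈ IntQ := by
    intro v
    rcases v with _ | i
    · rw [Fintype.sum_option] at htot
      rw [eq_neg_of_add_eq_zero_left htot]
      exact neg_mem (sum_mem fun i _ => hsome i)
    · exact hsome i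
  obtain ⟨g, hg1, hg2⟩ := net (srcE G col) (tgtE G col) (srcE_ne G col) _ f hf hb rfl
  have hg : ∀ i : Fin d, u (Fin.castSucc i) = ∑ e, (g e : ℤ) * vecE G col e (Fin.castSucc i) := by
    intro i
    have h1 := hg1 (some i)
    rw [hs, hs, ← hu] at h1
    have h2 : (sgnE col i : ℚ) * sgnE col i = 1 := by exact_mod_cast sgnE_sq col i
    have h3 : (sgnE col i : ℚ) ≠ 0 := left_ne_zero_of_mul_eq_one h2
    have h4 := mul_left_cancel₀ h3 h1
    exact_mod_cast h4.symm
  have hlast : (u (Fin.last d) : ℚ) = ∑ e, f e + c := by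
    rw [hw]; simp [zvec, vecE_last]
  have hle : ∑ e, (g e : ℤ) ≤ u (Fin.last d) := by
    have : ∑ e, (g e : ℚ) ≤ u (Fin.last d) := by rw [hlast]; linarith
    exact_mod_cast this
  obtain ⟨k, hk⟩ := Int.eq_ofNat_of_zero_le (sub_nonneg.2 hle)
  have hfin : u = ∑ e, g e • vecE G col e + k • zvec d := by
    ext i
    refine Fin.lastCases ?_ (fun i => ?_) i
    · simp only [Fintype.sum_sum_type] at hk
      simp [vecE_last, zvec]
      linarith
    · simp [zvec, hg]
  rw [hfin]
  have hz : zvec d ∈ AddSubmonoid.closure (Aset d G) :=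
    AddSubmonoid.subset_closure (Or.inl rfl : zvec d ∈ Aset d G)
  have hv : ∀ e, vecE G col e ∈ AddSubmonoid.closure (Aset d G) := fun e =>
    AddSubmonoid.subset_closure (vecE_mem G col e)
  exact add_mem (sum_mem fun e _ => nsmul_mem (hv e) _) (nsmul_mem hz _)

open Classical in
lemma closure_rep {d : ℕ} (G : SimpleGraph (Fin d)) (u : Fin (d + 1) → ℤ)
    (hu : u ∈ AddSubmonoid.closure (Aset d G)) :
    ∃ (s : Finset (Fin (d + 1) → ℤ)) (c : (Fin (d + 1) → ℤ) → ℚ),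
      (∀ a ∈ s, a ∈ Aset d G) ∧ (∀ a, 0 ≤ c a) ∧ (∀ a, a ∉ s → c a = 0) ∧
        ∀ i, (u i : ℚ) = ∑ a ∈ s, c a * (a i : ℚ) := by
  induction hu using AddSubmonoid.closure_induction with
  | mem a ha =>
    refine ⟨{a}, Pi.single a 1, by simpa using ha, fun b => ?_, fun b hb => ?_, by simp⟩
    · by_cases h : b = a
      · subst h; simp
      · simp [h]
    · simp at hb; simp [hb]
  | zero => exact ⟨∅, 0, by simp, by simp, by simp, by simp⟩
  | add x y _ _ hx hy =>
    obtain ⟨s, c, h1, h2, h3, h4⟩ := hx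
    obtain ⟨s', c', h1', h2', h3', h4'⟩ := hy
    refine ⟨s ∪ s', c + c', ?_, fun a => add_nonneg (h2 a) (h2' a), ?_, ?_⟩
    · intro a ha
      rcases Finset.mem_union.1 ha with h | h
      · exact h1 a h
      · exact h1' a h
    · intro a ha
      rw [Finset.mem_union, not_or] at ha
      simp [h3 a ha.1, h3' a ha.2]
    · intro i
      simp only [Pi.add_apply, add_mul, Finset.sum_add_distrib, Int.cast_add, h4, h4']
      congr 1
      · exact Finset.sum_subset Finset.subset_union_left (fun a _ ha => by simp [h3 a ha])
      · exact Finset.sum_subset Finset.subset_union_right (fun a _ ha => by simp [h3' a ha])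

lemma closure_ne_one {d : ℕ} (G : SimpleGraph (Fin d)) (u : Fin (d + 1) → ℤ)
    (hu : u ∈ AddSubmonoid.closure (Aset d G)) :
    0 ≤ 2 * u (Fin.last d) - ∑ i : Fin d, u (Fin.castSucc i) ∧
      2 * u (Fin.last d) - ∑ i : Fin d, u (Fin.castSucc i) ≠ 1 := by
  induction hu using AddSubmonoid.closure_induction with
  | mem a ha =>
    rcases ha with rfl | ⟨i, j, hij, rfl⟩ | ⟨i, rfl⟩
    · simp
    · simp [Finset.sum_add_distrib]
    · simp
  | zero => simp
  | add x y _ _ hx hy =>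
    simp only [Pi.add_apply, Finset.sum_add_distrib]
    omega

lemma walk_vec {d : ℕ} (G : SimpleGraph (Fin d)) {a b : Fin d} (w : G.Walk a b) :
    ∃ T : Fin d → ℤ, ∑ i, T i = w.length ∧
      (Fin.snoc (2 • T + Pi.single a 1 - Pi.single b 1) (w.length : ℤ) : Fin (d + 1) → ℤ)
        ∈ AddSubmonoid.closure (Aset d G) := by
  induction w with
  | nil =>
    refine ⟨0, by simp, ?_⟩
    convert zero_mem (AddSubmonoid.closure (Aset d G))
    ext i
    refine Fin.lastCases ?_ (fun i => ?_) i <;> simp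
  | @cons a b c hab p ih =>
    obtain ⟨T, hT, hm⟩ := ih
    refine ⟨T + Pi.single b 1, by simp [Finset.sum_add_distrib, hT], ?_⟩
    have h2 : (Fin.snoc (Pi.single a 1 + Pi.single b 1) (1 : ℤ) : Fin (d + 1) → ℤ)
        ∈ AddSubmonoid.closure (Aset d G) :=
      AddSubmonoid.subset_closure (Or.inr (Or.inl ⟨a, b, hab, rfl⟩))
    convert add_mem hm h2 using 1
    ext i
    refine Fin.lastCases ?_ (fun i => ?_) i
    · simp
    · simp; ring

/-- `G` is bipartite iff `ℤ_{≥0}A = ℚ_{≥0}A ∩ ℤ^{d+1}` for the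
configuration `A` of `Q(G)^∨`, i.e. iff `Q(G)^∨` is normal. -/
theorem stmt14 (d : ℕ) (hd : 1 ≤ d) (G : SimpleGraph (Fin d))
    (hiso : ∀ i : Fin d, ∃ j, G.Adj i j) :
    G.Colorable 2 ↔
      ∀ u : Fin (d + 1) → ℤ,
        (∃ (s : Finset (Fin (d + 1) → ℤ)) (c : (Fin (d + 1) → ℤ) → ℚ),
          ↑s ⊆ Aset d G ∧ (∀ a ∈ s, 0 ≤ c a) ∧
            ∀ i, (u i : ℚ) = ∑ a ∈ s, c a * (a i : ℚ)) →
        u ∈ AddSubmonoid.closure (Aset d G) := by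
  constructor
  · rintro ⟨C⟩ u ⟨s, c, hs, hc, hu⟩
    have hcol : ∀ i j, G.Adj i j → C i ≠ C j := fun i j h => C.valid h
    apply forward G C hcol
    have key : ∀ t : Finset (Fin (d + 1) → ℤ), t ⊆ s →
        PP G C (fun i => ∑ a ∈ t, c a * (a i : ℚ)) := by
      classical
      intro t
      induction t using Finset.induction_on with
      | empty => intro _; exact ⟨0, 0, by simp, le_rfl, by simp⟩
      | insert a t ha ih =>
        intro hsub
        have h1 := ih ((Finset.subset_insert a t).trans hsub)
        have has : a ∈ s := hsub (Finset.mem_insert_self a t)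
        have h2 := PP_A G C hcol a (hs has) (c a) (hc a has)
        convert PP_add G C _ _ h2 h1 using 1
        ext i
        simp [Finset.sum_insert ha]
    have := key s (Finset.Subset.refl s)
    convert this using 2 with i
    exact hu i
  · intro H
    rw [SimpleGraph.two_colorable_iff_forall_loop_even]
    intro a w
    by_contra hodd
    rw [Nat.not_even_iff_odd] at hodd
    obtain ⟨k, hk⟩ := hodd
    obtain ⟨T, hT, hm⟩ := walk_vec G w
    have hm2 := add_mem hm (AddSubmonoid.subset_closure (Or.inl rfl : zvec d ∈ Aset d G))
    obtain ⟨s, c, h1, h2, h3, h4⟩ := closure_rep G _ hm2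
    have hin := H (Fin.snoc T ((k : ℤ) + 1)) ⟨s, fun a => c a / 2, fun a ha => h1 a ha,
      fun a _ => by have := h2 a; positivity, fun i => ?_⟩
    · have := (closure_ne_one G _ hin).2
      simp [hT, hk] at this
      omega
    · have h5 := h4 i
      have h6 : ∑ a ∈ s, c a / 2 * (a i : ℚ) = (∑ a ∈ s, c a * (a i : ℚ)) / 2 := by
        rw [Finset.sum_div]
        apply Finset.sum_congr rfl
        intro a _
        ring
      rw [h6, ← h5]
      refine Fin.lastCases ?_ (fun i => ?_) i
      · simp [zvec, hk]; ring
      · simp [zvec]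
end
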